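/- arXiv:1710.05904 — 4 statements merged into one kernel-verified Lean document; each statement's English description precedes it below -/
import Mathlib

section
/- Let G be a finitely presented group with H_1(G,ℤ) = 0 and H_2(G,ℤ) ≠ 0. Then there exists a positive constant C such that d(Gⁿ) ≤ C·log(n+1) for all n ≥ 1, and there exist positive constants b₁, b₂ such that b₁·n ≤ ρ(Gⁿ) ≤ b₂·n for all n ≥ 1. -/
/-- `Γ` has a presentation with `k` generators and at most `l` relators:
a surjection from the free group of rank `k` whose kernel is the normal
closure of a set of at most `l` elements. -/
def HasPresentationCard (Γ : Type*) [Group Γ] (k l : ℕ) : Prop :=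
  ∃ φ : FreeGroup (Fin k) →* Γ, Function.Surjective φ ∧
    ∃ R : Set (FreeGroup (Fin k)), R.Finite ∧ R.ncard ≤ l ∧
      φ.ker = Subgroup.normalClosure R

/-- `Γ` is finitely presented. -/
def FinitelyPresented (Γ : Type*) [Group Γ] : Prop :=
  ∃ k l, HasPresentationCard Γ k l

/-- `d(Γ)`: the minimal cardinality of a (finite) generating set of `Γ`. -/
noncomputable def dGen (Γ : Type*) [Group Γ] : ℕ :=
  sInf {d | ∃ S : Set Γ, S.Finite ∧ S.ncard = d ∧ Subgroup.closure S = ⊤}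

/-- `ρ(Γ)`: the minimal number of relators among all finite presentations of `Γ`. -/
noncomputable def rho (Γ : Type*) [Group Γ] : ℕ :=
  sInf {l | ∃ k, HasPresentationCard Γ k l}

/-- The kernel `R` of the canonical presentation of `G` by the free group on
the underlying set of `G`. -/
abbrev freeKernel (G : Type*) [Group G] : Subgroup (FreeGroup G) :=
  (FreeGroup.lift (id : G → G)).ker

/-- `H₂(G,ℤ)`, presented via Hopf's formula `H₂(G,ℤ) ≅ (R ⊓ [F,F]) / [F,R]`
applied to the canonical free presentation `1 → R → F → G → 1` with `F` the
free group on the underlying set of `G`. -/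
abbrev H2 (G : Type*) [Group G] : Type _ :=
  ↥(freeKernel G ⊓ commutator (FreeGroup G)) ⧸
    (⁅(⊤ : Subgroup (FreeGroup G)), freeKernel G⁆.subgroupOf
      (freeKernel G ⊓ commutator (FreeGroup G)))

section Aux

universe u

open scoped commutatorElement

/-- Presentation with generators indexed by `ι` and relators by `κ`. -/
def HasPres (Γ : Type*) [Group Γ] (ι κ : Type) : Prop :=
  ∃ (φ : FreeGroup ι →* Γ) (r : κ → FreeGroup ι), Function.Surjective φ ∧
    φ.ker = Subgroup.normalClosure (Set.range r)

theorem HasPres.of_card {Γ : Type*} [Group Γ] {k l : ℕ} (h : HasPresentationCard Γ k l) :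
    ∃ κ : Type, Nonempty (Fintype κ) ∧ HasPres Γ (Fin k) κ := by
  obtain ⟨φ, hφ, R, hR, -, hk⟩ := h
  exact ⟨R, ⟨hR.fintype⟩, φ, fun r => r.1, hφ, by simpa using hk⟩

theorem HasPres.to_card {Γ : Type*} [Group Γ] {ι κ : Type} [Fintype ι] [Fintype κ]
    (h : HasPres Γ ι κ) : HasPresentationCard Γ (Fintype.card ι) (Fintype.card κ) := by
  obtain ⟨φ, r, hφ, hk⟩ := h
  let e : FreeGroup ι ≃* FreeGroup (Fin (Fintype.card ι)) :=
    FreeGroup.freeGroupCongr (Fintype.equivFin ι)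
  refine ⟨φ.comp e.symm.toMonoidHom, hφ.comp e.symm.surjective, Set.range (e ∘ r),
    Set.finite_range _, ?_, ?_⟩
  · have := Set.ncard_image_le (f := e ∘ r) (s := Set.univ) Set.finite_univ
    rw [Set.image_univ, Set.ncard_univ, Nat.card_eq_fintype_card] at this
    exact this
  · have h1 := Subgroup.map_normalClosure (Set.range r) e.toMonoidHom e.surjective
    rw [← hk, ] at h1
    rw [Set.range_comp]
    refine Eq.trans ?_ h1
    ext x
    simp only [MonoidHom.mem_ker, Subgroup.mem_map]
    constructor
    · intro h
      exact ⟨e.symm x, h, by simp⟩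
    · rintro ⟨y, hy, rfl⟩
      simpa using hy

theorem HasPres.change {Γ : Type*} [Group Γ] {ι κ μ : Type} (h : HasPres Γ ι κ)
    (ψ : FreeGroup μ →* Γ) (hψ : Function.Surjective ψ) : HasPres Γ μ (κ ⊕ μ) := by
  obtain ⟨φ, r, hφ, hk⟩ := h
  choose u hu using fun x : ι => hψ (φ (FreeGroup.of x))
  choose w hw using fun z : μ => hφ (ψ (FreeGroup.of z))
  let α := FreeGroup.lift u
  let β := FreeGroup.lift w
  have hα : ψ.comp α = φ := by ext x; simp [α, hu]
  have hβ : φ.comp β = ψ := by ext x; simp [β, hw]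
  refine ⟨ψ, Sum.elim (fun c => α (r c)) (fun z => (FreeGroup.of z)⁻¹ * α (β (FreeGroup.of z))),
    hψ, ?_⟩
  set N := Subgroup.normalClosure (Set.range (Sum.elim (fun c => α (r c))
    (fun z => (FreeGroup.of z)⁻¹ * α (β (FreeGroup.of z))))) with hN
  apply le_antisymm
  · intro x hx
    have h1 : (QuotientGroup.mk' N).comp (α.comp β) = QuotientGroup.mk' N := by
      ext z
      simp only [MonoidHom.comp_apply, QuotientGroup.mk'_apply]
      symm
      rw [QuotientGroup.eq]
      exact Subgroup.subset_normalClosure ⟨Sum.inr z, rfl⟩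
    have h2 : β x ∈ φ.ker := by
      rw [MonoidHom.mem_ker, ← MonoidHom.comp_apply, hβ]; exact hx
    have h3 : φ.ker ≤ N.comap α := by
      rw [hk]
      apply Subgroup.normalClosure_le_normal
      rintro _ ⟨c, rfl⟩
      exact Subgroup.subset_normalClosure ⟨Sum.inl c, rfl⟩
    have h4 : α (β x) ∈ N := h3 h2
    have h5 := DFunLike.congr_fun h1 x
    simp only [MonoidHom.comp_apply, QuotientGroup.mk'_apply] at h5
    rw [← QuotientGroup.eq_one_iff] at h4 ⊢
    rw [← h5, h4]
  · apply Subgroup.normalClosure_le_normal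
    rintro _ ⟨c | z, rfl⟩
    · have : r c ∈ φ.ker := hk ▸ Subgroup.subset_normalClosure ⟨c, rfl⟩
      change ψ (α (r c)) = 1
      rw [← MonoidHom.comp_apply, hα]; exact this
    · change ψ ((FreeGroup.of z)⁻¹ * α (β (FreeGroup.of z))) = 1
      rw [map_mul, ← MonoidHom.comp_apply, hα, ← MonoidHom.comp_apply, hβ, map_inv]
      simp

theorem HasPres.quot {A B : Type*} [Group A] [Group B] {ι κ σ : Type} (h : HasPres A ι κ)
    (f : A →* B) (hf : Function.Surjective f) (s : σ → A)
    (hs : f.ker = Subgroup.normalClosure (Set.range s)) : HasPres B ι (κ ⊕ σ) := by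
  obtain ⟨φ, r, hφ, hk⟩ := h
  choose t ht using fun c => hφ (s c)
  refine ⟨f.comp φ, Sum.elim r t, hf.comp hφ, ?_⟩
  rw [Set.Sum.elim_range]
  apply le_antisymm
  · intro x hx
    set N := Subgroup.normalClosure (Set.range r ∪ Set.range t) with hN
    have h1 : φ.ker ≤ N := by
      rw [hk]; exact Subgroup.normalClosure_mono Set.subset_union_left
    have h2 : N.Normal := Subgroup.normalClosure_normal
    have h3 : (N.map φ).Normal := h2.map φ hφ
    have h4 : f.ker ≤ N.map φ := by
      rw [hs]
      apply Subgroup.normalClosure_le_normal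
      rintro _ ⟨c, rfl⟩
      exact ⟨t c, Subgroup.subset_normalClosure (Or.inr ⟨c, rfl⟩), ht c⟩
    obtain ⟨y, hy, hyx⟩ := h4 (show φ x ∈ f.ker from hx)
    have h5 : y⁻¹ * x ∈ N := h1 (by rw [MonoidHom.mem_ker, map_mul, map_inv, hyx]; simp)
    simpa using N.mul_mem hy h5
  · apply Subgroup.normalClosure_le_normal
    rintro _ (⟨c, rfl⟩ | ⟨c, rfl⟩)
    · have : r c ∈ φ.ker := hk ▸ Subgroup.subset_normalClosure ⟨c, rfl⟩
      change f (φ (r c)) = 1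
      rw [MonoidHom.mem_ker.1 this, map_one]
    · change f (φ (t c)) = 1
      rw [ht]
      have : s c ∈ f.ker := hs ▸ Subgroup.subset_normalClosure ⟨c, rfl⟩
      exact this

theorem HasPres.congr {A B : Type*} [Group A] [Group B] {ι κ : Type} (h : HasPres A ι κ)
    (e : A ≃* B) : HasPres B ι κ := by
  obtain ⟨φ, r, hφ, hk⟩ := h
  refine ⟨e.toMonoidHom.comp φ, r, e.surjective.comp hφ, ?_⟩
  rw [← hk]; ext x; simp [MonoidHom.mem_ker]

theorem HasPres.prod {A B : Type*} [Group A] [Group B] {ι κ ι' κ' : Type} (h : HasPres A ι κ)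
    (h' : HasPres B ι' κ') : HasPres (A × B) (ι ⊕ ι') (κ ⊕ κ' ⊕ ι × ι') := by
  obtain ⟨φ, r, hφ, hk⟩ := h
  obtain ⟨φ', r', hφ', hk'⟩ := h'
  let Φ : FreeGroup (ι ⊕ ι') →* A × B :=
    FreeGroup.lift (Sum.elim (fun x => (φ (FreeGroup.of x), 1)) (fun y => (1, φ' (FreeGroup.of y))))
  let i : FreeGroup ι →* FreeGroup (ι ⊕ ι') := FreeGroup.map Sum.inl
  let j : FreeGroup ι' →* FreeGroup (ι ⊕ ι') := FreeGroup.map Sum.inr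
  have hi : Φ.comp i = (MonoidHom.inl A B).comp φ := by ext x <;> simp [Φ, i]
  have hj : Φ.comp j = (MonoidHom.inr A B).comp φ' := by ext x <;> simp [Φ, j]
  let rel : κ ⊕ κ' ⊕ ι × ι' → FreeGroup (ι ⊕ ι') :=
    Sum.elim (fun c => i (r c)) (Sum.elim (fun c => j (r' c))
      (fun p => ⁅(FreeGroup.of (Sum.inl p.1) : FreeGroup (ι ⊕ ι')), FreeGroup.of (Sum.inr p.2)⁆))
  refine ⟨Φ, rel, ?_, ?_⟩
  · rintro ⟨a, b⟩
    obtain ⟨x, rfl⟩ := hφ a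
    obtain ⟨y, rfl⟩ := hφ' b
    refine ⟨i x * j y, ?_⟩
    rw [map_mul, ← MonoidHom.comp_apply, ← MonoidHom.comp_apply, hi, hj]
    simp
  apply le_antisymm
  · set N := Subgroup.normalClosure (Set.range rel) with hN
    let q := QuotientGroup.mk' N
    have hrel : ∀ c, q (rel c) = 1 := fun c =>
      (QuotientGroup.eq_one_iff _).2 (Subgroup.subset_normalClosure ⟨c, rfl⟩)
    have h1 : φ.ker ≤ (q.comp i).ker := by
      rw [hk]
      apply Subgroup.normalClosure_le_normal
      rintro _ ⟨c, rfl⟩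
      exact hrel (Sum.inl c)
    have h2 : φ'.ker ≤ (q.comp j).ker := by
      rw [hk']
      apply Subgroup.normalClosure_le_normal
      rintro _ ⟨c, rfl⟩
      exact hrel (Sum.inr (Sum.inl c))
    let f := φ.liftOfSurjective hφ ⟨q.comp i, h1⟩
    let g := φ'.liftOfSurjective hφ' ⟨q.comp j, h2⟩
    have hf : ∀ x, f (φ x) = q (i x) := fun x =>
      MonoidHom.liftOfRightInverse_comp_apply φ _ _ ⟨q.comp i, h1⟩ x
    have hg : ∀ x, g (φ' x) = q (j x) := fun x =>
      MonoidHom.liftOfRightInverse_comp_apply φ' _ _ ⟨q.comp j, h2⟩ x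
    have hc0 : ∀ x y, Commute (q (i (FreeGroup.of x))) (q (j (FreeGroup.of y))) := by
      intro x y
      rw [← commutatorElement_eq_one_iff_commute, ← map_commutatorElement]
      have := hrel (Sum.inr (Sum.inr (x, y)))
      simpa [rel, i, j] using this
    have hc1 : ∀ x y, Commute (q (i x)) (q (j (FreeGroup.of y))) := by
      intro x y
      induction x using FreeGroup.induction_on with
      | C1 => simp
      | of x => exact hc0 x y
      | inv_of x hx => simpa using hx.inv_left
      | mul x x' hx hx' => simpa using hx.mul_left hx'
    have hc : ∀ x y, Commute (q (i x)) (q (j y)) := by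
      intro x y
      induction y using FreeGroup.induction_on with
      | C1 => simp
      | of y => exact hc1 x y
      | inv_of y hy => simpa using hy.inv_right
      | mul y y' hy hy' => simpa using hy.mul_right hy'
    have hcomm : ∀ a b, Commute (f a) (g b) := by
      intro a b
      obtain ⟨x, rfl⟩ := hφ a
      obtain ⟨y, rfl⟩ := hφ' b
      rw [hf, hg]; exact hc x y
    have key : (f.noncommCoprod g hcomm).comp Φ = q := by
      ext (x | y)
      · simp [Φ, MonoidHom.noncommCoprod_apply, hf, i]
      · simp [Φ, MonoidHom.noncommCoprod_apply, hg, j]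
    intro x hx
    rw [← QuotientGroup.eq_one_iff]
    change q x = 1
    rw [← key, MonoidHom.comp_apply, MonoidHom.mem_ker.1 hx, map_one]
  · apply Subgroup.normalClosure_le_normal
    rintro _ ⟨c | c | ⟨x, y⟩, rfl⟩
    · have : r c ∈ φ.ker := hk ▸ Subgroup.subset_normalClosure ⟨c, rfl⟩
      change Φ (i (r c)) = 1
      rw [← MonoidHom.comp_apply, hi, MonoidHom.comp_apply, MonoidHom.mem_ker.1 this, map_one]
    · have : r' c ∈ φ'.ker := hk' ▸ Subgroup.subset_normalClosure ⟨c, rfl⟩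
      change Φ (j (r' c)) = 1
      rw [← MonoidHom.comp_apply, hj, MonoidHom.comp_apply, MonoidHom.mem_ker.1 this, map_one]
    · change Φ _ = 1
      simp [rel, Φ, commutatorElement_def]

/-- Copies of `G` along a set of coordinates. -/
noncomputable def along {J G : Type*} [Group G] (S : Set J) : G →* (J → G) :=
  open scoped Classical in
  { toFun := fun g x => if x ∈ S then g else 1
    map_one' := by ext; simp
    map_mul' := by intro a b; ext x; by_cases h : x ∈ S <;> simp [h] }

theorem along_apply {J G : Type*} [Group G] (S : Set J) (g : G) (x : J) [Decidable (x ∈ S)] :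
    along S g x = if x ∈ S then g else 1 := by
  simp [along]

theorem along_inter {J G : Type*} [Group G] (hG : commutator G = ⊤) (H : Subgroup (J → G))
    (S T : Set J) (hS : ∀ g, along S g ∈ H) (hT : ∀ g, along T g ∈ H) (g : G) :
    along (S ∩ T) g ∈ H := by
  classical
  have : commutator G ≤ H.comap (along (S ∩ T)) := by
    rw [commutator_def, Subgroup.commutator_le]
    intro a _ b _
    have h : along (S ∩ T) ⁅a, b⁆ = ⁅along (J := J) S a, along T b⁆ := by
      ext x
      by_cases h1 : x ∈ S <;> by_cases h2 : x ∈ T <;>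
        simp [along_apply, h1, h2, commutatorElement_def]
    rw [Subgroup.mem_comap, h, commutatorElement_def]
    exact H.mul_mem (H.mul_mem (H.mul_mem (hS _) (hT _)) (H.inv_mem (hS _))) (H.inv_mem (hT _))
  exact this (hG ▸ Subgroup.mem_top g)

theorem exists_gens {G : Type*} [Group G] (hG : commutator G = ⊤) {k : ℕ} (a : Fin k → G)
    (ha : Subgroup.closure (Set.range a) = ⊤) (n m : ℕ) (hn : n ≤ 2 ^ m) :
    ∃ ψ : FreeGroup (Fin (m + 1) × Bool × Fin k) →* (Fin n → G), Function.Surjective ψ := by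
  classical
  let S : Fin (m + 1) → Bool → Set (Fin n) := fun j ε => {x | x.1.testBit j = ε}
  let ψ : FreeGroup (Fin (m + 1) × Bool × Fin k) →* (Fin n → G) :=
    FreeGroup.lift (fun t => along (S t.1 t.2.1) (a t.2.2))
  refine ⟨ψ, ?_⟩
  rw [← MonoidHom.range_eq_top]
  have h1 : ∀ j ε g, along (S j ε) g ∈ ψ.range := by
    intro j ε g
    have : Subgroup.closure (Set.range a) ≤ ψ.range.comap (along (S j ε)) := by
      rw [Subgroup.closure_le]
      rintro _ ⟨i, rfl⟩
      exact ⟨FreeGroup.of (j, ε, i), by simp [ψ]⟩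
    exact this (ha ▸ Subgroup.mem_top g)
  have h2 : ∀ x : Fin n, ∀ p ≤ m, ∀ g,
      along {y : Fin n | ∀ j < p + 1, y.1.testBit j = x.1.testBit j} g ∈ ψ.range := by
    intro x p
    induction p with
    | zero =>
      intro _ g
      convert h1 0 (x.1.testBit 0) g using 2
      ext y; simp [S]
    | succ p ih =>
      intro hp g
      have := along_inter hG ψ.range _ _ (ih (by omega)) (h1 ⟨p + 1, by omega⟩ (x.1.testBit (p+1))) g
      convert this using 3
      ext y
      simp only [S, Set.mem_inter_iff, Set.mem_ofPred_eq]
      constructor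
      · intro h
        exact ⟨fun j hj => h j (by omega), h _ (by omega)⟩
      · rintro ⟨h, h'⟩ j hj
        rcases Nat.lt_succ_iff_lt_or_eq.1 hj with h3 | rfl
        · exact h j h3
        · exact h'
  rw [eq_top_iff]
  intro f _
  apply Subgroup.pi_mem_of_mulSingle_mem
  intro x
  convert h2 x m le_rfl (f x) using 1
  ext y
  rw [along_apply, Pi.mulSingle_apply]
  have : y = x ↔ y ∈ {y : Fin n | ∀ j < m + 1, y.1.testBit j = x.1.testBit j} := by
    constructor
    · rintro rfl; simp
    · intro h
      apply Fin.ext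
      apply Nat.eq_of_testBit_eq
      intro j
      by_cases hj : j < m + 1
      · exact h j hj
      · have hm : 2 ^ m ≤ 2 ^ j := Nat.pow_le_pow_right (by norm_num) (by omega)
        rw [Nat.testBit_lt_two_pow (by omega), Nat.testBit_lt_two_pow (by omega)]
  by_cases h : y = x
  · rw [if_pos h, if_pos (this.1 h)]
  · rw [if_neg h, if_neg (fun h' => h (this.2 h'))]

/-- Splitting a power of `G`. -/
def powEquiv (G : Type*) [Group G] (m : ℕ) :
    ((Fin (2 ^ m) → G) × (Fin (2 ^ m) → G)) ≃* (Fin (2 ^ (m + 1)) → G) where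
  toEquiv := (Equiv.sumArrowEquivProdArrow _ _ _).symm.trans
    (Equiv.arrowCongr (finSumFinEquiv.trans (finCongr (by ring))) (Equiv.refl G))
  map_mul' := by
    intro x y
    ext i
    simp only [Equiv.toFun_as_coe, Equiv.trans_apply, Equiv.arrowCongr_apply, Function.comp_apply,
      Equiv.refl_apply, Pi.mul_apply]
    generalize (finSumFinEquiv.trans (finCongr _)).symm i = s
    rcases s with s | s <;> rfl

theorem upper_pow {G : Type*} [Group G] (hG : commutator G = ⊤) {k : ℕ} {κ₀ : Type} [Fintype κ₀]
    (h : HasPres G (Fin k) κ₀) (a : Fin k → G) (ha : Subgroup.closure (Set.range a) = ⊤) :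
    ∃ D : ℕ, ∀ m : ℕ, ∃ κ : Type, ∃ _ : Fintype κ,
      HasPres (Fin (2 ^ m) → G) (Fin (m + 1) × Bool × Fin k) κ ∧
      Fintype.card κ + (4 * k ^ 2 + 4 * k) * (m ^ 2 + 4 * m + 6) ≤ D * 2 ^ m := by
  refine ⟨Fintype.card κ₀ + 2 * k + (4 * k ^ 2 + 4 * k) * 6, fun m => ?_⟩
  induction m with
  | zero =>
    obtain ⟨ψ, hψ⟩ := exists_gens hG a ha (2 ^ 0) 0 le_rfl
    have : Unique (Fin (2 ^ 0)) := inferInstanceAs (Unique (Fin 1))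
    refine ⟨_, inferInstance, (h.congr (MulEquiv.piUnique fun _ : Fin (2 ^ 0) => G).symm).change
      ψ hψ, ?_⟩
    simp
  | succ m ih =>
    obtain ⟨κ, _, h1, h2⟩ := ih
    obtain ⟨ψ, hψ⟩ := exists_gens hG a ha (2 ^ (m + 1)) (m + 1) le_rfl
    refine ⟨_, inferInstance, ((h1.prod h1).congr (powEquiv G m)).change ψ hψ, ?_⟩
    simp only [Fintype.card_sum, Fintype.card_prod, Fintype.card_fin, Fintype.card_bool]
    rw [pow_succ 2 m, ← mul_assoc]
    nlinarith [Nat.zero_le (k * m), Nat.zero_le (k * m ^ 2), Nat.zero_le (k^2 * m)]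

theorem upper {G : Type*} [Group G] (hG : commutator G = ⊤) (hFP : FinitelyPresented G) :
    ∃ k D : ℕ, ∀ n m : ℕ, n ≤ 2 ^ m →
      (∃ ψ : FreeGroup (Fin (m + 1) × Bool × Fin k) →* (Fin n → G), Function.Surjective ψ) ∧
      ∃ k' l, HasPresentationCard (Fin n → G) k' l ∧ l ≤ D * 2 ^ m := by
  classical
  obtain ⟨k, l, h⟩ := hFP
  obtain ⟨κ₀, ⟨_⟩, h⟩ := HasPres.of_card h
  obtain ⟨a, ha⟩ : ∃ a : Fin k → G, Subgroup.closure (Set.range a) = ⊤ := by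
    obtain ⟨φ, -, hφ, -⟩ := h
    refine ⟨fun i => φ (FreeGroup.of i), ?_⟩
    have : Set.range (fun i => φ (FreeGroup.of i)) = φ '' Set.range FreeGroup.of := by
      rw [← Set.range_comp]; rfl
    rw [this, ← MonoidHom.map_closure, FreeGroup.closure_range_of, Subgroup.map_top_of_surjective _ hφ]
  obtain ⟨D, hD⟩ := upper_pow hG h a ha
  refine ⟨k, D + k, fun n m hn => ⟨exists_gens hG a ha n m hn, ?_⟩⟩
  obtain ⟨κ, _, h1, h2⟩ := hD m
  let f : (Fin (2 ^ m) → G) →* (Fin n → G) :=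
    { toFun := fun x i => x (Fin.castLE hn i), map_one' := rfl, map_mul' := fun _ _ => rfl }
  let s : Fin (2 ^ m) × Fin k → (Fin (2 ^ m) → G) :=
    fun t => if t.1.1 < n then 1 else Pi.mulSingle t.1 (a t.2)
  have h3 := h1.quot f (fun y => ⟨fun x => if hx : x.1 < n then y ⟨x.1, hx⟩ else 1, by
    ext i; simp [f]⟩) s (by
    apply le_antisymm
    · intro x hx
      apply Subgroup.pi_mem_of_mulSingle_mem
      intro i
      by_cases hi : i.1 < n
      · have : x i = 1 := congrFun (MonoidHom.mem_ker.1 hx) ⟨i.1, hi⟩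
        rw [this, Pi.mulSingle_one]
        exact Subgroup.one_mem _
      · have : Subgroup.closure (Set.range a) ≤ (Subgroup.normalClosure (Set.range s)).comap
            (MonoidHom.mulSingle (fun _ => G) i) := by
          rw [Subgroup.closure_le]
          rintro _ ⟨c, rfl⟩
          exact Subgroup.subset_normalClosure ⟨(i, c), by simp [s, hi]⟩
        exact this (ha ▸ Subgroup.mem_top (x i))
    · apply Subgroup.normalClosure_le_normal
      rintro _ ⟨⟨i, c⟩, rfl⟩
      change f (s (i, c)) = 1
      by_cases hi : i.1 < n
      · simp [s, hi]
      · ext j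
        have : Fin.castLE hn j ≠ i := by
          rintro rfl; exact hi j.2
        simp [s, hi, f, this])
  refine ⟨_, _, h3.to_card, ?_⟩
  simp only [Fintype.card_sum, Fintype.card_prod, Fintype.card_fin]
  nlinarith [Nat.zero_le ((4 * k ^ 2 + 4 * k) * (m ^ 2 + 4 * m + 6))]

theorem exists_pow (n : ℕ) (hn : 1 ≤ n) : ∃ m, n ≤ 2 ^ m ∧ 2 ^ m ≤ 2 * n := by
  induction n, hn using Nat.le_induction with
  | base => exact ⟨0, by norm_num, by norm_num⟩
  | succ n hn ih =>
    obtain ⟨m, h1, h2⟩ := ih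
    by_cases h : n + 1 ≤ 2 ^ m
    · exact ⟨m, h, by omega⟩
    · exact ⟨m + 1, by rw [pow_succ]; omega, by rw [pow_succ]; omega⟩

theorem commutator_le_of_central {E : Type*} [Group E] (T : Subgroup E)
    (h : ∀ x : E, ∃ t ∈ T, t⁻¹ * x ∈ Subgroup.center E) : commutator E ≤ ⁅T, T⁆ := by
  rw [commutator_def, Subgroup.commutator_le]
  intro a _ b _
  obtain ⟨s, hs, hsa⟩ := h a
  obtain ⟨t, ht, htb⟩ := h b
  have : ⁅a, b⁆ = ⁅s, t⁆ := by
    obtain ⟨z, rfl⟩ : ∃ z, a = s * z := ⟨s⁻¹ * a, by simp⟩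
    obtain ⟨w, rfl⟩ : ∃ w, b = t * w := ⟨t⁻¹ * b, by simp⟩
    simp only [inv_mul_cancel_left, Subgroup.mem_center_iff] at hsa htb
    have hz : ⁅s * z, t * w⁆ = ⁅s, t * w⁆ := by
      simp only [commutatorElement_def, mul_inv_rev]
      have := hsa (t * w)
      calc s * z * (t * w) * (z⁻¹ * s⁻¹) * (w⁻¹ * t⁻¹)
          = s * (z * (t * w)) * (z⁻¹ * s⁻¹) * (w⁻¹ * t⁻¹) := by group
        _ = _ := by rw [← this]; group
    have hw : ⁅s, t * w⁆ = ⁅s, t⁆ := by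
      simp only [commutatorElement_def, mul_inv_rev]
      have := htb s⁻¹
      calc s * (t * w) * s⁻¹ * (w⁻¹ * t⁻¹)
          = s * t * (w * s⁻¹) * (w⁻¹ * t⁻¹) := by group
        _ = _ := by rw [← this]; group
    rw [hz, hw]
  rw [this]
  exact Subgroup.commutator_mem_commutator hs ht

theorem central_gen {E Γ : Type*} [Group E] [Group Γ] (p : E →* Γ) (hp : Function.Surjective p)
    (hc : p.ker ≤ Subgroup.center E) (hE : commutator E = ⊤) {k l : ℕ}
    (h : HasPresentationCard Γ k l) :
    ∃ S : Set p.ker, S.Finite ∧ S.ncard ≤ l ∧ Subgroup.closure S = ⊤ := by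
  obtain ⟨φ, hφ, R, hR, hl, hk⟩ := h
  choose u hu using fun x => hp (φ (FreeGroup.of x))
  let ψ : FreeGroup (Fin k) →* E := FreeGroup.lift u
  have hψ : p.comp ψ = φ := by ext x; simp [ψ, hu]
  have hψ' : ∀ x, p (ψ x) = φ x := fun x => DFunLike.congr_fun hψ x
  have hsurj : Function.Surjective ψ := by
    rw [← MonoidHom.range_eq_top, eq_top_iff, ← hE]
    refine (commutator_le_of_central ψ.range ?_).trans (Subgroup.commutator_le.2 ?_)
    · intro x
      obtain ⟨y, hy⟩ := hφ (p x)
      refine ⟨ψ y, ⟨y, rfl⟩, hc ?_⟩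
      rw [MonoidHom.mem_ker, map_mul, map_inv, hψ', hy]
      simp
    · intro a ha b hb
      rw [commutatorElement_def]
      exact mul_mem (mul_mem (mul_mem ha hb) (inv_mem ha)) (inv_mem hb)
  have hker : Subgroup.closure (ψ '' R) = p.ker := by
    have h1 : p.ker = Subgroup.normalClosure (ψ '' R) := by
      rw [← Subgroup.map_normalClosure _ _ hsurj, ← hk]
      ext x
      simp only [Subgroup.mem_map, MonoidHom.mem_ker]
      constructor
      · intro hx
        obtain ⟨y, rfl⟩ := hsurj x
        exact ⟨y, by rw [← hψ', hx], rfl⟩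
      · rintro ⟨y, hy, rfl⟩
        rw [hψ', hy]
    have h2 : Subgroup.closure (ψ '' R) ≤ p.ker := by
      rw [h1]; exact Subgroup.closure_le_normalClosure
    apply le_antisymm h2
    have : (Subgroup.closure (ψ '' R)).Normal := by
      constructor
      intro n hn g
      have := Subgroup.mem_center_iff.1 (hc (h2 hn)) g
      rw [this]; simpa using hn
    rw [h1]
    exact Subgroup.normalClosure_le_normal Subgroup.subset_closure
  have hsub : ψ '' R ⊆ Set.range ((↑) : p.ker → E) := by
    rw [Subtype.range_coe_subtype]
    intro x hx
    have := Subgroup.subset_closure hx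
    rw [hker] at this
    exact this
  refine ⟨((↑) : p.ker → E) ⁻¹' (ψ '' R), (hR.image ψ).preimage Subtype.coe_injective.injOn, ?_, ?_⟩
  · rw [Set.ncard_preimage_of_injective_subset_range Subtype.coe_injective hsub]
    exact (Set.ncard_image_le hR).trans hl
  · apply Subgroup.map_injective p.ker.subtype_injective
    rw [MonoidHom.map_closure, ← MonoidHom.range_eq_map, Subgroup.range_subtype]
    rw [← hker]
    congr 1
    rw [hker]
    exact Set.image_preimage_eq_of_subset hsub

theorem exists_field_quot (A : Type*) [CommGroup A] [Group.FG A] [Nontrivial A] :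
    ∃ (K : Type) (_ : Field K) (f : A →* Multiplicative K), Function.Surjective f := by
  have : Module.Finite ℤ (Additive A) := Module.Finite.iff_addGroup_fg.2 inferInstance
  obtain ⟨N, hN, -⟩ := (eq_top_or_exists_le_coatom (⊥ : Submodule ℤ (Additive A))).resolve_left
    bot_ne_top
  have hs := isSimpleModule_iff_isCoatom.2 hN
  obtain ⟨I, hI, ⟨e⟩⟩ := isSimpleModule_iff_quot_maximal.1 hs
  let : Field (ℤ ⧸ I) := Ideal.Quotient.field I
  refine ⟨ℤ ⧸ I, inferInstance, AddMonoidHom.toMultiplicativeRight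
    (e.toLinearMap.comp N.mkQ).toAddMonoidHom, ?_⟩
  intro y
  obtain ⟨x, hx⟩ := (e.surjective.comp N.mkQ_surjective) y.toAdd
  exact ⟨x.toMul, hx⟩

theorem lower {E G : Type*} [Group E] [Group G] (p : E →* G) (hp : Function.Surjective p)
    (hc : p.ker ≤ Subgroup.center E) (hE : commutator E = ⊤) (hA : Nontrivial p.ker)
    (hFP : FinitelyPresented G) {n k l : ℕ} (h : HasPresentationCard (Fin n → G) k l) : n ≤ l := by
  classical
  let : CommGroup p.ker := { (inferInstance : Group p.ker) with
    mul_comm := fun a b => Subtype.ext (Subgroup.mem_center_iff.1 (hc b.2) a) }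
  have : Group.FG p.ker := by
    obtain ⟨k, l, h⟩ := hFP
    obtain ⟨S, hS, -, h⟩ := central_gen p hp hc hE h
    exact Group.fg_iff.2 ⟨S, h, hS⟩
  obtain ⟨K, _, f, hf⟩ := exists_field_quot p.ker
  let P : (Fin n → E) →* (Fin n → G) :=
    { toFun := fun x i => p (x i)
      map_one' := by ext; simp
      map_mul' := by intros; ext; simp }
  have hPk : ∀ x : P.ker, ∀ i, x.1 i ∈ p.ker := fun x i => congrFun (MonoidHom.mem_ker.1 x.2) i
  obtain ⟨S, hS, hl, hcl⟩ := central_gen P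
    (fun y => ⟨fun i => (hp (y i)).choose, funext fun i => (hp (y i)).choose_spec⟩)
    (by
      intro x hx
      rw [Subgroup.mem_center_iff]
      intro y
      ext i
      exact Subgroup.mem_center_iff.1 (hc (hPk ⟨x, hx⟩ i)) (y i))
    (by
      rw [eq_top_iff]
      intro x _
      apply Subgroup.pi_mem_of_mulSingle_mem
      intro i
      have : commutator E ≤ (commutator (Fin n → E)).comap (MonoidHom.mulSingle (fun _ => E) i) := by
        rw [commutator_def, Subgroup.commutator_le]
        intro a _ b _
        rw [Subgroup.mem_comap, map_commutatorElement]
        exact Subgroup.commutator_mem_commutator (Subgroup.mem_top _) (Subgroup.mem_top _)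
      exact this (hE ▸ Subgroup.mem_top (x i))) h
  refine le_trans ?_ hl
  let g : P.ker → (Fin n → K) := fun x i => (f ⟨x.1 i, hPk x i⟩).toAdd
  have g1 : g 1 = 0 := by
    ext i
    exact congrArg Multiplicative.toAdd (map_one f)
  have gm : ∀ x y, g (x * y) = g x + g y := by
    intro x y
    ext i
    exact congrArg Multiplicative.toAdd (map_mul f ⟨x.1 i, hPk x i⟩ ⟨y.1 i, hPk y i⟩)
  have gi : ∀ x, g x⁻¹ = - g x := by
    intro x
    rw [eq_neg_iff_add_eq_zero, ← gm, inv_mul_cancel, g1]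
  have hspan : Submodule.span K (g '' S) = ⊤ := by
    rw [eq_top_iff]
    intro v _
    choose x hx using fun i => hf (Multiplicative.ofAdd (v i))
    have hxm : (fun i => (x i).1) ∈ P.ker := funext fun i => (x i).2
    have hg : g ⟨_, hxm⟩ = v := by
      ext i
      exact congrArg Multiplicative.toAdd (hx i)
    rw [← hg]
    have hm : (⟨_, hxm⟩ : P.ker) ∈ Subgroup.closure S := hcl ▸ Subgroup.mem_top _
    generalize (⟨_, hxm⟩ : P.ker) = z at hm
    clear hg
    induction hm using Subgroup.closure_induction with
    | mem x hx => exact Submodule.subset_span ⟨x, hx, rfl⟩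
    | one => rw [g1]; exact Submodule.zero_mem _
    | mul x y _ _ h1 h2 => rw [gm]; exact Submodule.add_mem _ h1 h2
    | inv x _ h1 => rw [gi]; exact Submodule.neg_mem _ h1
  have : Fintype S := hS.fintype
  have : Fintype (g '' S) := (hS.image g).fintype
  have h1 := finrank_span_le_card (R := K) (g '' S)
  rw [hspan, finrank_top, Module.finrank_fin_fun, ← Set.ncard_eq_toFinset_card'] at h1
  exact h1.trans (Set.ncard_image_le hS)

theorem map_commutator_surj {A B : Type*} [Group A] [Group B] (f : A →* B)
    (hf : Function.Surjective f) : (commutator A).map f = commutator B := by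
  rw [commutator_def, commutator_def, Subgroup.map_commutator, Subgroup.map_top_of_surjective _ hf]

theorem exists_cover (G : Type u) [Group G] (hG : commutator G = ⊤) (hH2 : Nontrivial (H2 G)) :
    ∃ (E : Type u) (_ : Group E) (p : E →* G), Function.Surjective p ∧
      p.ker ≤ Subgroup.center E ∧ commutator E = ⊤ ∧ Nontrivial p.ker := by
  let K : Subgroup (FreeGroup G) := ⁅(⊤ : Subgroup (FreeGroup G)), freeKernel G⁆
  let q := QuotientGroup.mk' K
  have hq : Function.Surjective q := QuotientGroup.mk'_surjective K
  have hKR : K ≤ freeKernel G := Subgroup.commutator_le_right _ _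
  let π : FreeGroup G ⧸ K →* G := QuotientGroup.lift K (FreeGroup.lift id) hKR
  have hπq : ∀ x, π (q x) = FreeGroup.lift id x := fun x => rfl
  have hπ : Function.Surjective π := fun g => ⟨q (FreeGroup.of g), by rw [hπq]; simp⟩
  have hcen : π.ker ≤ Subgroup.center (FreeGroup G ⧸ K) := by
    intro x hx
    obtain ⟨x, rfl⟩ := hq x
    rw [Subgroup.mem_center_iff]
    intro y
    obtain ⟨y, rfl⟩ := hq y
    rw [← commutatorElement_eq_one_iff_mul_comm, ← map_commutatorElement]
    exact (QuotientGroup.eq_one_iff _).2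
      (Subgroup.commutator_mem_commutator (Subgroup.mem_top _) hx)
  let C := commutator (FreeGroup G ⧸ K)
  have hCmap : C.map π = ⊤ := by
    rw [← hG]
    exact map_commutator_surj π hπ
  have hsurj : Function.Surjective (π.comp C.subtype) := by
    intro g
    obtain ⟨x, hx, rfl⟩ : g ∈ C.map π := hCmap ▸ Subgroup.mem_top g
    exact ⟨⟨x, hx⟩, rfl⟩
  refine ⟨C, inferInstance, π.comp C.subtype, hsurj, ?_, ?_, ?_⟩
  · intro x hx
    rw [Subgroup.mem_center_iff]
    intro y
    exact Subtype.ext (Subgroup.mem_center_iff.1 (hcen (show x.1 ∈ π.ker from hx)) y.1)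
  · have h1 : C ≤ ⁅C, C⁆ := by
      apply commutator_le_of_central
      intro x
      obtain ⟨t, ht⟩ := hsurj (π x)
      refine ⟨t.1, t.2, hcen ?_⟩
      rw [MonoidHom.mem_ker, map_mul, map_inv]
      change (π.comp C.subtype t)⁻¹ * _ = 1
      rw [ht]; simp
    apply Subgroup.map_injective C.subtype_injective
    rw [Subgroup.map_subtype_commutator, ← MonoidHom.range_eq_map, Subgroup.range_subtype]
    exact le_antisymm (Subgroup.commutator_le_left _ _) h1
  · by_contra hA
    rw [not_nontrivial_iff_subsingleton] at hA
    apply not_subsingleton_iff_nontrivial.2 hH2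
    refine ⟨fun a b => ?_⟩
    have key : ∀ a : H2 G, a = ((1 : ↥(freeKernel G ⊓ commutator (FreeGroup G))) : H2 G) := by
      intro a
      induction a using QuotientGroup.induction_on with
      | H x =>
      rw [eq_comm, QuotientGroup.eq, inv_one, one_mul, Subgroup.mem_subgroupOf]
      have hx : q x.1 ∈ C := by
        have : q x.1 ∈ (commutator (FreeGroup G)).map q := ⟨x.1, x.2.2, rfl⟩
        exact (map_commutator_surj q hq).le this
      have h2 : (⟨q x.1, hx⟩ : C) ∈ (π.comp C.subtype).ker := x.2.1
      have h3 := congrArg Subtype.val (congrArg Subtype.val (Subsingleton.elim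
        (⟨_, h2⟩ : (π.comp C.subtype).ker) 1))
      exact (QuotientGroup.eq_one_iff _).1 h3
    rw [key a, key b]

end Aux

/-- If `G` is finitely presented with `H₁(G,ℤ) = 0` and `H₂(G,ℤ) ≠ 0`, then
`d(Gⁿ) = O(log n)` and `ρ(Gⁿ) = Θ(n)`. -/
theorem stmt_1 (G : Type*) [Group G] (hFP : FinitelyPresented G)
    (hH1 : Subsingleton (Abelianization G)) (hH2 : Nontrivial (H2 G)) :
    (∃ C : ℝ, 0 < C ∧ ∀ n : ℕ, 1 ≤ n →
      (dGen (Fin n → G) : ℝ) ≤ C * Real.log (n + 1)) ∧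
    (∃ b₁ b₂ : ℝ, 0 < b₁ ∧ 0 < b₂ ∧ ∀ n : ℕ, 1 ≤ n →
      b₁ * n ≤ (rho (Fin n → G) : ℝ) ∧ (rho (Fin n → G) : ℝ) ≤ b₂ * n) := by
  have hG : commutator G = ⊤ := by
    rw [eq_top_iff]
    intro g _
    have : (QuotientGroup.mk g : G ⧸ commutator G) = 1 := hH1.elim _ _
    exact (QuotientGroup.eq_one_iff g).1 this
  obtain ⟨k, D, hkD⟩ := upper hG hFP
  obtain ⟨E, _, p, hp, hc, hE, hA⟩ := exists_cover G hG hH2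
  have hlog2 : 0 < Real.log 2 := Real.log_pos (by norm_num)
  refine ⟨⟨6 * k / Real.log 2 + 1, by positivity, fun n hn => ?_⟩,
    1, 2 * D + 1, by norm_num, by positivity, fun n hn => ?_⟩
  · obtain ⟨m, hm1, hm2⟩ := exists_pow n hn
    obtain ⟨ψ, hψ⟩ := (hkD n m hm1).1
    have h1 : dGen (Fin n → G) ≤ (m + 1) * (2 * k) := by
      have hmem : (Set.range fun t => ψ (FreeGroup.of t)).ncard ∈
          {d | ∃ S : Set (Fin n → G), S.Finite ∧ S.ncard = d ∧ Subgroup.closure S = ⊤} := by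
        refine ⟨_, Set.finite_range _, rfl, ?_⟩
        have : Set.range (fun i => ψ (FreeGroup.of i)) = ψ '' Set.range FreeGroup.of := by
          rw [← Set.range_comp]; rfl
        rw [this, ← MonoidHom.map_closure, FreeGroup.closure_range_of,
          Subgroup.map_top_of_surjective _ hψ]
      refine (Nat.sInf_le hmem).trans ?_
      have := Set.ncard_image_le (f := fun t => ψ (FreeGroup.of t)) (s := Set.univ) Set.finite_univ
      rw [Set.image_univ, Set.ncard_univ, Nat.card_eq_fintype_card] at this
      simpa using this
    have hn' : (1 : ℝ) ≤ n := by exact_mod_cast hn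
    have hL : Real.log 2 ≤ Real.log (n + 1) := Real.log_le_log (by norm_num) (by linarith)
    have hm3 : m * Real.log 2 ≤ Real.log 2 + Real.log (n + 1) := by
      rw [← Real.log_pow, ← Real.log_mul (by norm_num) (by positivity)]
      apply Real.log_le_log (by positivity)
      have : ((2 ^ m : ℕ) : ℝ) ≤ ((2 * n : ℕ) : ℝ) := by exact_mod_cast hm2
      push_cast at this
      linarith
    have hm4 : ((m : ℝ) + 1) ≤ 3 * Real.log (n + 1) / Real.log 2 := by
      rw [le_div_iff₀ hlog2]; linarith
    have h2 : (dGen (Fin n → G) : ℝ) ≤ (m + 1) * (2 * k) := by exact_mod_cast h1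
    have h3 : ((m : ℝ) + 1) * (2 * k) ≤ 3 * Real.log (n + 1) / Real.log 2 * (2 * k) := by gcongr
    have h4 : (6 * k / Real.log 2 + 1) * Real.log (n + 1)
        = 3 * Real.log (n + 1) / Real.log 2 * (2 * k) + Real.log (n + 1) := by ring
    linarith
  · obtain ⟨m, hm1, hm2⟩ := exists_pow n hn
    obtain ⟨k', l, hP, hl⟩ := (hkD n m hm1).2
    have hne : l ∈ {l | ∃ k, HasPresentationCard (Fin n → G) k l} := ⟨k', hP⟩
    obtain ⟨k'', hP'⟩ := Nat.sInf_mem ⟨l, hne⟩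
    have h1 : n ≤ rho (Fin n → G) := lower p hp hc hE hA hFP hP'
    have h2 : rho (Fin n → G) ≤ l := Nat.sInf_le hne
    have h3 : rho (Fin n → G) ≤ (2 * D + 1) * n := by
      have := Nat.mul_le_mul_left D hm2
      nlinarith
    exact ⟨by rw [one_mul]; exact_mod_cast h1, by exact_mod_cast h3⟩
end

section
/- Let G be a finitely presented group with H_1(G,ℤ) = 0 and H_2(G,ℤ) = 0. Then there exists a positive constant C such that for every integer n ≥ 2 the direct power Gⁿ admits a finite presentation with at most C·log n generators and at most C·(log n)³ relators. -/
open scoped commutatorElement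

/-- Superperfect: perfect, and the kernel of each central extension meets the commutator trivially. -/
def SPerf (H : Type*) [Group H] : Prop :=
  commutator H = ⊤ ∧ ∀ (E : Type) [Group E] (p : E →* H), Function.Surjective p →
    p.ker ≤ Subgroup.center E → ∀ z : E, p z = 1 → z ∈ commutator E → z = 1

theorem SPerf.of_equiv {H K : Type*} [Group H] [Group K] (e : H ≃* K) (h : SPerf H) :
    SPerf K := by
  refine ⟨?_, ?_⟩
  · have := congrArg (Subgroup.map e.toMonoidHom) h.1
    rw [commutator_def, Subgroup.map_commutator,
      Subgroup.map_top_of_surjective _ e.surjective] at this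
    rw [commutator_def]; exact this
  · intro E _ p hp hc z hz hzE
    refine h.2 E (e.symm.toMonoidHom.comp p) (e.symm.surjective.comp hp) ?_ z ?_ hzE
    · intro y hy
      apply hc
      simpa [MonoidHom.mem_ker] using hy
    · simp [hz]

/-- Elements of a central extension: derived subgroup is the image of that of a supplement. -/
theorem commutator_le_of_central_s2 {E : Type*} [Group E] (S : Subgroup E)
    (hS : ∀ e : E, ∃ s ∈ S, ∃ z ∈ Subgroup.center E, e = s * z) :
    commutator E ≤ ⁅S, S⁆ := by
  rw [commutator_def, Subgroup.commutator_le]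
  intro a _ b _
  obtain ⟨s, hs, z, hz, rfl⟩ := hS a
  obtain ⟨t, ht, y, hy, rfl⟩ := hS b
  have h1 : ⁅s * z, t * y⁆ = ⁅s, t⁆ := by
    rw [Subgroup.mem_center_iff] at hz hy
    rw [commutatorElement_def, commutatorElement_def, mul_inv_rev, mul_inv_rev]
    calc s * z * (t * y) * (z⁻¹ * s⁻¹) * (y⁻¹ * t⁻¹)
        = s * (z * (t * y)) * z⁻¹ * s⁻¹ * y⁻¹ * t⁻¹ := by group
      _ = s * t * (y * s⁻¹) * y⁻¹ * t⁻¹ := by rw [← hz (t * y)]; group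
      _ = s * t * s⁻¹ * t⁻¹ := by rw [← hy s⁻¹]; group
  rw [h1]
  exact Subgroup.commutator_mem_commutator hs ht

theorem sPerf_of_H2 (G : Type*) [Group G]
    (hH1 : Subsingleton (Abelianization G)) (hH2 : Subsingleton (H2 G)) : SPerf G := by
  refine ⟨?_, ?_⟩
  · have := QuotientGroup.subgroup_eq_top_of_subsingleton (commutator G) hH1
    exact this
  · intro E _ p hp hc z hz hzE
    choose s hs using hp
    let f : FreeGroup G →* E := FreeGroup.lift s
    have hf : ∀ w, p (f w) = FreeGroup.lift (id : G → G) w := by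
      intro w
      have : p.comp f = FreeGroup.lift (id : G → G) := by
        ext g; simp [f, hs]
      exact DFunLike.congr_fun this w
    have h1 : commutator E ≤ ⁅f.range, f.range⁆ := by
      apply commutator_le_of_central_s2
      intro e
      refine ⟨f (FreeGroup.of (p e)), ⟨_, rfl⟩, (f (FreeGroup.of (p e)))⁻¹ * e, hc ?_, by group⟩
      simp [MonoidHom.mem_ker, hf]
    have h2 : ⁅f.range, f.range⁆ = Subgroup.map f (commutator (FreeGroup G)) := by
      rw [commutator_def, Subgroup.map_commutator, MonoidHom.range_eq_map]
    obtain ⟨w, hw, rfl⟩ := h2 ▸ h1 hzE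
    have hwR : w ∈ freeKernel G := by
      rw [MonoidHom.mem_ker, ← hf]; exact hz
    have h3 := QuotientGroup.subgroup_eq_top_of_subsingleton
      (⁅(⊤ : Subgroup (FreeGroup G)), freeKernel G⁆.subgroupOf
        (freeKernel G ⊓ commutator (FreeGroup G))) hH2
    have h4 : w ∈ ⁅(⊤ : Subgroup (FreeGroup G)), freeKernel G⁆ := by
      rw [Subgroup.subgroupOf_eq_top] at h3
      exact h3 ⟨hwR, hw⟩
    have h5 : ⁅(⊤ : Subgroup (FreeGroup G)), freeKernel G⁆ ≤ f.ker := by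
      rw [Subgroup.commutator_le]
      intro a _ b hb
      have : f b ∈ Subgroup.center E := by
        apply hc
        rw [MonoidHom.mem_ker, hf]; exact hb
      rw [MonoidHom.mem_ker, map_commutatorElement, commutatorElement_eq_one_iff_mul_comm]
      exact Subgroup.mem_center_iff.1 this _
    exact h5 h4

theorem SPerf.prod {H K : Type*} [Group H] [Group K] (hH : SPerf H) (hK : SPerf K) :
    SPerf (H × K) := by
  have key : commutator (H × K) = ⊤ := by
    have h1 : Subgroup.map (MonoidHom.inl H K) ⊤ ≤ commutator (H × K) := by
      rw [← hH.1, commutator_def, Subgroup.map_commutator]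
      exact Subgroup.commutator_mono le_top le_top
    have h2 : Subgroup.map (MonoidHom.inr H K) ⊤ ≤ commutator (H × K) := by
      rw [← hK.1, commutator_def, Subgroup.map_commutator]
      exact Subgroup.commutator_mono le_top le_top
    rw [eq_top_iff]
    rintro ⟨a, b⟩ -
    have := mul_mem (h1 ⟨a, trivial, rfl⟩) (h2 ⟨b, trivial, rfl⟩)
    simpa using this
  refine ⟨key, ?_⟩
  intro E _ p hp hc z hz hzE
  let E1 : Subgroup E := ((MonoidHom.snd H K).comp p).ker
  let E2 : Subgroup E := ((MonoidHom.fst H K).comp p).ker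
  have hE1 : ∀ e, e ∈ E1 ↔ (p e).2 = 1 := fun e => Iff.rfl
  have hE2 : ∀ e, e ∈ E2 ↔ (p e).1 = 1 := fun e => Iff.rfl
  -- the two restricted extensions
  let p1 : E1 →* H := ((MonoidHom.fst H K).comp p).comp E1.subtype
  let p2 : E2 →* K := ((MonoidHom.snd H K).comp p).comp E2.subtype
  have sp1 : Function.Surjective p1 := by
    intro h
    obtain ⟨e, he⟩ := hp (h, 1)
    exact ⟨⟨e, by simp [hE1, he]⟩, by simp [p1, he]⟩
  have sp2 : Function.Surjective p2 := by
    intro h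
    obtain ⟨e, he⟩ := hp (1, h)
    exact ⟨⟨e, by simp [hE2, he]⟩, by simp [p2, he]⟩
  have c1 : p1.ker ≤ Subgroup.center E1 := by
    rintro ⟨e, he⟩ hk
    have : e ∈ Subgroup.center E := hc (by
      rw [MonoidHom.mem_ker]; exact Prod.ext hk he)
    rw [Subgroup.mem_center_iff] at this ⊢
    intro g; exact Subtype.ext (this g)
  have c2 : p2.ker ≤ Subgroup.center E2 := by
    rintro ⟨e, he⟩ hk
    have : e ∈ Subgroup.center E := hc (by
      rw [MonoidHom.mem_ker]; exact Prod.ext he hk)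
    rw [Subgroup.mem_center_iff] at this ⊢
    intro g; exact Subtype.ext (this g)
  have map1 : Subgroup.map E1.subtype (commutator E1) = ⁅E1, E1⁆ := by
    rw [commutator_def, Subgroup.map_commutator, ← MonoidHom.range_eq_map, Subgroup.range_subtype]
  have map2 : Subgroup.map E2.subtype (commutator E2) = ⁅E2, E2⁆ := by
    rw [commutator_def, Subgroup.map_commutator, ← MonoidHom.range_eq_map, Subgroup.range_subtype]
  have inj1 : ∀ e ∈ ⁅E1, E1⁆, p e = 1 → e = 1 := by
    intro e he hpe
    rw [← map1] at he
    obtain ⟨y, hy, rfl⟩ := he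
    have := hH.2 E1 p1 sp1 c1 y (by
      change (p (E1.subtype y)).1 = 1
      rw [hpe]; rfl) hy
    rw [this]; simp
  have inj2 : ∀ e ∈ ⁅E2, E2⁆, p e = 1 → e = 1 := by
    intro e he hpe
    rw [← map2] at he
    obtain ⟨y, hy, rfl⟩ := he
    have := hK.2 E2 p2 sp2 c2 y (by
      change (p (E2.subtype y)).2 = 1
      rw [hpe]; rfl) hy
    rw [this]; simp
  -- commuting
  have hZ : ⁅E1, E2⁆ ≤ Subgroup.center E := by
    rw [Subgroup.commutator_le]
    intro a ha b hb
    apply hc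
    rw [hE1] at ha
    rw [hE2] at hb
    rw [MonoidHom.mem_ker, map_commutatorElement]
    ext <;> simp [commutatorElement_def, ha, hb]
  have hZ' : ∀ S : Subgroup E, ⁅⁅E1, E2⁆, S⁆ = ⊥ := by
    intro S
    rw [Subgroup.commutator_eq_bot_iff_le_centralizer]
    exact hZ.trans (Subgroup.center_le_centralizer _)
  have comm12 : ⁅⁅E1, E1⁆, E2⁆ = ⊥ := by
    apply Subgroup.commutator_commutator_eq_bot_of_rotate
    · exact hZ' _
    · rw [Subgroup.commutator_comm E2 E1]; exact hZ' _
  have hcomm : ∀ a ∈ ⁅E1, E1⁆, ∀ b ∈ ⁅E2, E2⁆, a * b = b * a := by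
    intro a ha b hb
    rw [Subgroup.commutator_eq_bot_iff_le_centralizer] at comm12
    have h2 : b ∈ E2 := (Subgroup.commutator_le_self E2) hb
    exact (Subgroup.mem_centralizer_iff.1 (comm12 ha) b h2).symm
  -- images
  have im1 : ∀ h : H, ∃ e ∈ ⁅E1, E1⁆, p e = (h, 1) := by
    intro h
    have : h ∈ Subgroup.map p1 (commutator E1) := by
      rw [commutator_def, Subgroup.map_commutator, Subgroup.map_top_of_surjective _ sp1,
        ← commutator_def, hH.1]; trivial
    obtain ⟨y, hy, rfl⟩ := this
    refine ⟨y, map1 ▸ ⟨y, hy, rfl⟩, ?_⟩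
    exact Prod.ext rfl y.2
  have im2 : ∀ h : K, ∃ e ∈ ⁅E2, E2⁆, p e = (1, h) := by
    intro h
    have : h ∈ Subgroup.map p2 (commutator E2) := by
      rw [commutator_def, Subgroup.map_commutator, Subgroup.map_top_of_surjective _ sp2,
        ← commutator_def, hK.1]; trivial
    obtain ⟨y, hy, rfl⟩ := this
    refine ⟨y, map2 ▸ ⟨y, hy, rfl⟩, ?_⟩
    exact Prod.ext y.2 rfl
  have hle : commutator E ≤ ⁅E1, E1⁆ ⊔ ⁅E2, E2⁆ := by
    refine (commutator_le_of_central_s2 (⁅E1, E1⁆ ⊔ ⁅E2, E2⁆) ?_).trans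
      (Subgroup.commutator_le_self _)
    intro e
    obtain ⟨a, ha, hpa⟩ := im1 (p e).1
    obtain ⟨b, hb, hpb⟩ := im2 (p e).2
    refine ⟨a * b, Subgroup.mul_mem_sup ha hb, (a * b)⁻¹ * e, hc ?_, by group⟩
    rw [MonoidHom.mem_ker]
    ext <;> simp [hpa, hpb]
  have : (⁅E1, E1⁆).Normal := Subgroup.commutator_normal _ _
  obtain ⟨a, ha, b, hb, rfl⟩ := Subgroup.mem_sup_of_normal_left.1 (hle hzE)
  have pa : (p a).2 = 1 := Subgroup.commutator_le_self E1 ha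
  have pb : (p b).1 = 1 := Subgroup.commutator_le_self E2 hb
  rw [map_mul] at hz
  have z1 : (p a).1 * (p b).1 = 1 := congrArg Prod.fst hz
  have z2 : (p a).2 * (p b).2 = 1 := congrArg Prod.snd hz
  rw [pb, mul_one] at z1
  rw [pa, one_mul] at z2
  rw [inj1 a ha (Prod.ext z1 pa), inj2 b hb (Prod.ext pb z2), one_mul]

/-- A presentation on an arbitrary generating type. -/
def PresOn (H : Type*) [Group H] (α : Type) (x : α → H) (R : Set (FreeGroup α)) : Prop :=
  Function.Surjective (FreeGroup.lift x) ∧ (FreeGroup.lift x).ker = Subgroup.normalClosure R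

theorem doubling {H : Type*} [Group H] (hH : SPerf H) {α : Type} [Finite α] {x : α → H}
    {R : Set (FreeGroup α)} (hR : R.Finite) (hP : PresOn H α x R) {c : ℕ} (u : Fin c → H)
    (hu : Subgroup.normalClosure (Set.range u) = ⊤) :
    ∃ (y : α ⊕ Fin c → H × H) (R' : Set (FreeGroup (α ⊕ Fin c))), R'.Finite ∧
      R'.ncard ≤ R.ncard + Nat.card α ^ 2 + c ∧ PresOn (H × H) (α ⊕ Fin c) y R' := by
  classical
  obtain ⟨hsurj, hker⟩ := hP
  let X : α → (FreeGroup (α ⊕ Fin c)) := fun i => FreeGroup.of (Sum.inl i)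
  let Y : Fin c → (FreeGroup (α ⊕ Fin c)) := fun s => FreeGroup.of (Sum.inr s)
  let ι : FreeGroup α →* (FreeGroup (α ⊕ Fin c)) := FreeGroup.lift X
  let ψu : (FreeGroup (α ⊕ Fin c)) →* H := FreeGroup.lift (Sum.elim x u)
  let ψ1 : (FreeGroup (α ⊕ Fin c)) →* H := FreeGroup.lift (Sum.elim x (fun _ => 1))
  have ψuι : ∀ f, ψu (ι f) = FreeGroup.lift x f := by
    intro f
    have : ψu.comp ι = FreeGroup.lift x := by ext i; simp [ψu, ι, X]
    exact DFunLike.congr_fun this f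
  have ψ1ι : ∀ f, ψ1 (ι f) = FreeGroup.lift x f := by
    intro f
    have : ψ1.comp ι = FreeGroup.lift x := by ext i; simp [ψ1, ι, X]
    exact DFunLike.congr_fun this f
  have ψus : Function.Surjective ψu := by
    intro h; obtain ⟨f, rfl⟩ := hsurj h; exact ⟨_, ψuι f⟩
  let N : Subgroup (FreeGroup (α ⊕ Fin c)) := Subgroup.normalClosure (Set.range Y)
  have hw : ∀ i, ∃ w ∈ ⁅N, (⊤ : Subgroup (FreeGroup (α ⊕ Fin c)))⁆, ψu w = x i := by
    intro i
    have h1 : Subgroup.map ψu N = ⊤ := by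
      rw [Subgroup.map_normalClosure _ _ ψus, ← Set.range_comp, ← hu]
      congr 2
      ext s; simp [ψu, Y]
    have h2 : Subgroup.map ψu ⁅N, (⊤ : Subgroup (FreeGroup (α ⊕ Fin c)))⁆ = ⊤ := by
      rw [Subgroup.map_commutator, h1, Subgroup.map_top_of_surjective _ ψus, ← commutator_def, hH.1]
    have : x i ∈ Subgroup.map ψu ⁅N, (⊤ : Subgroup (FreeGroup (α ⊕ Fin c)))⁆ := h2 ▸ trivial
    exact this
  choose w hwN hwx using hw
  have hw1 : ∀ i, ψ1 (w i) = 1 := by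
    intro i
    have : N ≤ ψ1.ker := by
      apply Subgroup.normalClosure_le_normal
      rintro _ ⟨s, rfl⟩
      simp [ψ1, Y, MonoidHom.mem_ker]
    exact this (Subgroup.commutator_le_left _ _ (hwN i))
  choose v hv using fun s => hsurj (u s)
  let W : FreeGroup α →* (FreeGroup (α ⊕ Fin c)) := FreeGroup.lift w
  have ψuW : ∀ f, ψu (W f) = FreeGroup.lift x f := by
    intro f
    have : ψu.comp W = FreeGroup.lift x := by ext i; simp [W, hwx]
    exact DFunLike.congr_fun this f
  have ψ1W : ∀ f, ψ1 (W f) = 1 := by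
    intro f
    have : ψ1.comp W = 1 := by ext i; simp [W, hw1]
    exact DFunLike.congr_fun this f
  let y : α ⊕ Fin c → H × H := fun a => (Sum.elim x u a, Sum.elim x (fun _ => 1) a)
  have hΦ : ∀ f, FreeGroup.lift y f = (ψu f, ψ1 f) := by
    intro f
    have : FreeGroup.lift y = ψu.prod ψ1 := by ext i <;> simp [y, ψu, ψ1]
    exact DFunLike.congr_fun this f
  let r2 : α × α → (FreeGroup (α ⊕ Fin c)) := fun ij => ⁅w ij.1, (w ij.2)⁻¹ * X ij.2⁆
  let r3 : Fin c → (FreeGroup (α ⊕ Fin c)) := fun s => (Y s)⁻¹ * W (v s)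
  let R' : Set (FreeGroup (α ⊕ Fin c)) := (ι '' R ∪ Set.range r2) ∪ Set.range r3
  refine ⟨y, R', ?_, ?_, ?_, ?_⟩
  · exact ((hR.image _).union (Set.finite_range _)).union (Set.finite_range _)
  · refine (Set.ncard_union_le _ _).trans (add_le_add ((Set.ncard_union_le _ _).trans
      (add_le_add (Set.ncard_image_le hR) ?_)) ?_)
    · rw [← Set.image_univ]
      refine (Set.ncard_image_le Set.finite_univ).trans ?_
      rw [Set.ncard_univ, Nat.card_prod, sq]
    · rw [← Set.image_univ]
      refine (Set.ncard_image_le Set.finite_univ).trans ?_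
      rw [Set.ncard_univ, Nat.card_fin]
  · rintro ⟨a, b⟩
    obtain ⟨f, rfl⟩ := hsurj a
    obtain ⟨g, rfl⟩ := hsurj b
    refine ⟨W f * (W g)⁻¹ * ι g, ?_⟩
    rw [hΦ]
    simp [ψuW, ψ1W, ψuι, ψ1ι]
  · let K : Subgroup (FreeGroup (α ⊕ Fin c)) := Subgroup.normalClosure R'
    have hKle : K ≤ (FreeGroup.lift y).ker := by
      apply Subgroup.normalClosure_le_normal
      rintro _ ((⟨r, hr, rfl⟩ | ⟨⟨i, j⟩, rfl⟩) | ⟨s, rfl⟩)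
      · have : r ∈ (FreeGroup.lift x).ker := hker ▸ Subgroup.subset_normalClosure hr
        rw [MonoidHom.mem_ker] at this
        simp [MonoidHom.mem_ker, hΦ, ψuι, ψ1ι, this]
      · have hX : ψu (X j) = x j := by simp [ψu, X]
        simp [MonoidHom.mem_ker, hΦ, r2, hwx, hw1, hX, commutatorElement_def]
      · have hX : ψu (Y s) = u s := by simp [ψu, Y]
        have hX1 : ψ1 (Y s) = 1 := by simp [ψ1, Y]
        simp [MonoidHom.mem_ker, hΦ, r3, ψuW, ψ1W, hX, hX1, hv]
    let Γ := FreeGroup (α ⊕ Fin c) ⧸ K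
    let q : (FreeGroup (α ⊕ Fin c)) →* Γ := QuotientGroup.mk' K
    have hq : Function.Surjective q := QuotientGroup.mk'_surjective K
    have hqK : ∀ f ∈ K, q f = 1 := fun f hf => (QuotientGroup.eq_one_iff f).2 hf
    let p : Γ →* H × H := QuotientGroup.lift K (FreeGroup.lift y) hKle
    have hpq : ∀ f, p (q f) = (ψu f, ψ1 f) := by
      intro f; rw [← hΦ]; rfl
    have qι : ∀ f, FreeGroup.lift x f = 1 → q (ι f) = 1 := by
      intro f hf
      have h1 : f ∈ Subgroup.normalClosure R := hker ▸ hf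
      have h2 : Subgroup.normalClosure R ≤ (q.comp ι).ker := by
        apply Subgroup.normalClosure_le_normal
        intro r hr
        exact hqK _ (Subgroup.subset_normalClosure (Or.inl (Or.inl ⟨r, hr, rfl⟩)))
      exact h2 h1
    have qY : ∀ s, q (Y s) = q (W (v s)) := by
      intro s
      have := hqK _ (Subgroup.subset_normalClosure (Or.inr ⟨s, rfl⟩) : r3 s ∈ K)
      simp only [r3, map_mul, map_inv] at this
      exact inv_mul_eq_one.1 this
    let A : Subgroup Γ := (q.comp W).range
    let B : Subgroup Γ := Subgroup.closure (Set.range fun j => q ((w j)⁻¹ * X j))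
    have hwA : ∀ i, q (w i) ∈ A := fun i => ⟨FreeGroup.of i, by simp [W]⟩
    have hA : A = Subgroup.closure (Set.range fun j => q (w j)) := by
      apply le_antisymm
      · rintro _ ⟨f, rfl⟩
        have h : q.comp W = FreeGroup.lift (fun j => q (w j)) := by ext i; simp [W]
        rw [h, ← FreeGroup.range_lift_eq_closure]
        exact ⟨f, rfl⟩
      · rw [Subgroup.closure_le]
        rintro _ ⟨j, rfl⟩
        exact hwA j
    have hAB : ∀ a ∈ A, ∀ b ∈ B, a * b = b * a := by
      have : A ≤ Subgroup.centralizer (B : Set Γ) := by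
        rw [hA, Subgroup.closure_le]
        rintro _ ⟨i, rfl⟩
        have h0 : B ≤ Subgroup.centralizer {q (w i)} := by
          rw [Subgroup.closure_le]
          rintro _ ⟨j, rfl⟩
          have := hqK _ (Subgroup.subset_normalClosure (Or.inl (Or.inr ⟨(i, j), rfl⟩)) : r2 (i, j) ∈ K)
          simp only [r2, map_commutatorElement, commutatorElement_eq_one_iff_mul_comm] at this
          rw [SetLike.mem_coe, Subgroup.mem_centralizer_singleton_iff]
          exact this.symm
        rw [SetLike.mem_coe, Subgroup.mem_centralizer_iff]
        intro b hb
        have := h0 hb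
        rwa [Subgroup.mem_centralizer_singleton_iff] at this
      intro a ha b hb
      exact (Subgroup.mem_centralizer_iff.1 (this ha) b hb).symm
    have hsup : A ⊔ B = ⊤ := by
      rw [eq_top_iff]
      have h : ∀ f, q f ∈ A ⊔ B := by
        intro f
        induction f using FreeGroup.induction_on with
        | C1 => simp
        | of a =>
          rcases a with i | s
          · have h1 : q (w i) * q ((w i)⁻¹ * X i) ∈ A ⊔ B :=
              Subgroup.mul_mem_sup (hwA i) (Subgroup.subset_closure ⟨i, rfl⟩)
            rw [← map_mul, mul_inv_cancel_left] at h1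
            exact h1
          · exact Subgroup.mem_sup_left (show q (Y s) ∈ A from qY s ▸ ⟨v s, rfl⟩)
        | inv_of a h => rw [map_inv]; exact inv_mem h
        | mul a b ha hb => rw [map_mul]; exact mul_mem ha hb
      intro g _
      obtain ⟨f, rfl⟩ := hq g
      exact h f
    have hAn : A.Normal := by
      rw [← Subgroup.normalizer_eq_top_iff, eq_top_iff, ← hsup, sup_le_iff]
      refine ⟨Subgroup.le_normalizer, fun b hb => ?_⟩
      apply Subgroup.centralizer_le_normalizer
      rw [Subgroup.mem_centralizer_iff]
      exact fun a ha => hAB a ha b hb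
    have hBn : B.Normal := by
      rw [← Subgroup.normalizer_eq_top_iff, eq_top_iff, ← hsup, sup_le_iff]
      refine ⟨fun a ha => ?_, Subgroup.le_normalizer⟩
      apply Subgroup.centralizer_le_normalizer
      rw [Subgroup.mem_centralizer_iff]
      exact fun b hb => (hAB a ha b hb).symm
    -- claim 2
    have claim2 : ∀ f, ψ1 f = 1 → q f ∈ A := by
      intro f hf
      let σ : (FreeGroup (α ⊕ Fin c)) →* FreeGroup α := FreeGroup.lift (Sum.elim FreeGroup.of (fun _ => 1))
      have h1 : (QuotientGroup.mk' A).comp q = (QuotientGroup.mk' A).comp (q.comp (ι.comp σ)) := by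
        ext a
        rcases a with i | s
        · simp [σ, ι, X]
        · have : q (Y s) ∈ A := qY s ▸ ⟨v s, rfl⟩
          have := (QuotientGroup.eq_one_iff (N := A) _).2 this
          simpa [σ] using this
      have h2 : FreeGroup.lift x (σ f) = ψ1 f := by
        have : (FreeGroup.lift x).comp σ = ψ1 := by
          ext a; rcases a with i | s <;> simp [σ, ψ1]
        exact DFunLike.congr_fun this f
      have h3 := DFunLike.congr_fun h1 f
      have h4 : q (ι (σ f)) = 1 := qι _ (h2.trans hf)
      simp only [MonoidHom.comp_apply, h4, map_one] at h3
      exact (QuotientGroup.eq_one_iff (N := A) _).1 h3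
    have claim1 : ∀ f, ψu f = 1 → q f ∈ B := by
      intro f hf
      let τ : (FreeGroup (α ⊕ Fin c)) →* FreeGroup α := FreeGroup.lift (Sum.elim FreeGroup.of v)
      have hWι : (QuotientGroup.mk' B).comp (q.comp W) = (QuotientGroup.mk' B).comp (q.comp ι) := by
        ext i
        have : q ((w i)⁻¹ * X i) ∈ B := Subgroup.subset_closure ⟨i, rfl⟩
        rw [map_mul, map_inv] at this
        have h := (QuotientGroup.eq (s := B)).2 this
        simpa [W, ι] using h
      have h1 : (QuotientGroup.mk' B).comp q = (QuotientGroup.mk' B).comp (q.comp (ι.comp τ)) := by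
        ext a
        rcases a with i | s
        · simp [τ, ι, X]
        · have := DFunLike.congr_fun hWι (v s)
          have h6 := congrArg (QuotientGroup.mk' B) (qY s)
          have h7 := h6.trans this
          simpa [τ, Y] using h7
      have h2 : FreeGroup.lift x (τ f) = ψu f := by
        have : (FreeGroup.lift x).comp τ = ψu := by
          ext a; rcases a with i | s <;> simp [τ, ψu, hv]
        exact DFunLike.congr_fun this f
      have h3 := DFunLike.congr_fun h1 f
      have h4 : q (ι (τ f)) = 1 := qι _ (h2.trans hf)
      simp only [MonoidHom.comp_apply, h4, map_one] at h3
      exact (QuotientGroup.eq_one_iff (N := B) _).1 h3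
    have hpsurj : Function.Surjective p := by
      rintro ⟨a, b⟩
      obtain ⟨f, rfl⟩ := hsurj a
      obtain ⟨g, rfl⟩ := hsurj b
      refine ⟨q (W f * (W g)⁻¹ * ι g), ?_⟩
      rw [hpq]
      simp [ψuW, ψ1W, ψuι, ψ1ι]
    have hcent : p.ker ≤ Subgroup.center Γ := by
      intro g hg
      obtain ⟨f, rfl⟩ := hq g
      rw [MonoidHom.mem_ker, hpq] at hg
      have gB := claim1 f (congrArg Prod.fst hg)
      have gA := claim2 f (congrArg Prod.snd hg)
      rw [Subgroup.mem_center_iff]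
      have h : A ⊔ B ≤ Subgroup.centralizer {q f} := by
        rw [sup_le_iff]
        refine ⟨fun a ha => ?_, fun b hb => ?_⟩
        · rw [Subgroup.mem_centralizer_singleton_iff]; exact hAB a ha _ gB
        · rw [Subgroup.mem_centralizer_singleton_iff]; exact (hAB _ gA b hb).symm
      intro g
      have := h (hsup ▸ trivial : g ∈ A ⊔ B)
      rwa [Subgroup.mem_centralizer_singleton_iff] at this
    have hperf : commutator Γ = ⊤ := by
      have hqc : ∀ f ∈ commutator (FreeGroup (α ⊕ Fin c)), q f ∈ commutator Γ := by
        intro f hf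
        have : Subgroup.map q (commutator (FreeGroup (α ⊕ Fin c))) ≤ commutator Γ := by
          rw [commutator_def, Subgroup.map_commutator]
          exact Subgroup.commutator_mono le_top le_top
        exact this ⟨f, hf, rfl⟩
      have hιc : ∀ f, q (ι f) ∈ commutator Γ := by
        intro f
        have h1 : FreeGroup.lift x f ∈ Subgroup.map (FreeGroup.lift x) (commutator (FreeGroup α)) := by
          rw [commutator_def, Subgroup.map_commutator, Subgroup.map_top_of_surjective _ hsurj,
            ← commutator_def, hH.1]; trivial
        obtain ⟨g, hg, hgf⟩ := h1
        have h2 : q (ι (f * g⁻¹)) = 1 := qι _ (by rw [map_mul, map_inv, hgf, mul_inv_cancel])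
        rw [map_mul, map_mul, map_inv, map_inv, mul_inv_eq_one] at h2
        rw [h2]
        apply hqc
        have : Subgroup.map ι (commutator (FreeGroup α)) ≤ commutator (FreeGroup (α ⊕ Fin c)) := by
          rw [commutator_def, Subgroup.map_commutator]
          exact Subgroup.commutator_mono le_top le_top
        exact this ⟨g, hg, rfl⟩
      have hAc : A ≤ commutator Γ := by
        rw [hA, Subgroup.closure_le]
        rintro _ ⟨j, rfl⟩
        exact hqc _ (Subgroup.commutator_mono le_top le_top (hwN j))
      have hBc : B ≤ commutator Γ := by
        rw [Subgroup.closure_le]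
        rintro _ ⟨j, rfl⟩
        have h1 := hιc (FreeGroup.of j)
        have h2 := hAc (hwA j)
        have : q ((w j)⁻¹ * X j) = (q (w j))⁻¹ * q (ι (FreeGroup.of j)) := by simp [ι]
        change q ((w j)⁻¹ * X j) ∈ _
        rw [this]
        exact mul_mem (inv_mem h2) h1
      rw [eq_top_iff, ← hsup]
      exact sup_le hAc hBc
    apply le_antisymm _ hKle
    intro f hf
    have h1 := (hH.prod hH).2 Γ p hpsurj hcent (q f) hf (hperf ▸ trivial)
    exact (QuotientGroup.eq_one_iff f).1 h1

theorem normal_gen {G : Type*} [Group G] (hG : commutator G = ⊤) {c : ℕ} (u : Fin c → G)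
    (hu : Subgroup.normalClosure (Set.range u) = ⊤) {X : Type} [Finite X] (T : Set X)
    (t : Fin c → X → G) (ht : ∀ s, ∀ a ∈ T, t s a = u s) (f : X → G) (hf : ∀ a, a ∉ T → f a = 1) :
    f ∈ Subgroup.normalClosure (Set.range t) := by
  classical
  set M := Subgroup.normalClosure (Set.range t) with hM
  have key : ∀ a ∈ T, ∀ g, Pi.mulSingle a g ∈ M := by
    intro a ha g
    let M1 : Subgroup G := M.comap (MonoidHom.mulSingle (fun _ : X => G) a)
    have : M1.Normal := Subgroup.Normal.comap inferInstance _
    let Z : Subgroup G := (Subgroup.center (G ⧸ M1)).comap (QuotientGroup.mk' M1)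
    have : Z.Normal := Subgroup.Normal.comap inferInstance _
    have h1 : Z = ⊤ := by
      rw [eq_top_iff, ← hu]
      apply Subgroup.normalClosure_le_normal
      rintro _ ⟨s, rfl⟩
      change _ ∈ Subgroup.center _
      rw [Subgroup.mem_center_iff]
      intro k
      obtain ⟨k, rfl⟩ := QuotientGroup.mk'_surjective M1 k
      rw [← map_mul, ← map_mul]
      apply (QuotientGroup.eq (s := M1)).2
      change Pi.mulSingle a _ ∈ M
      have h2 : (Pi.mulSingle a ((k * u s)⁻¹ * (u s * k)) : X → G) =
          (t s)⁻¹ * (Pi.mulSingle a k⁻¹ * t s * (Pi.mulSingle a k⁻¹)⁻¹) := by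
        ext b
        by_cases hb : b = a
        · subst hb
          simp [ht s b ha, mul_assoc]
        · simp [hb]
      have ht : t s ∈ M := Subgroup.subset_normalClosure ⟨s, rfl⟩
      rw [h2]
      exact mul_mem (inv_mem ht) (Subgroup.normalClosure_normal.conj_mem _ ht _)
    have h2 : commutator G ≤ M1 := by
      rw [commutator_def, Subgroup.commutator_le]
      intro b _ d _
      have : QuotientGroup.mk' M1 d ∈ Subgroup.center _ := (h1 ▸ trivial : d ∈ Z)
      rw [← QuotientGroup.eq_one_iff]
      change QuotientGroup.mk' M1 _ = 1
      rw [map_commutatorElement, commutatorElement_eq_one_iff_mul_comm]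
      exact Subgroup.mem_center_iff.1 this _
    exact (h2 (hG ▸ trivial : g ∈ commutator G))
  apply Subgroup.pi_mem_of_mulSingle_mem
  intro a
  by_cases ha : a ∈ T
  · exact key a ha _
  · rw [hf a ha, Pi.mulSingle_one]; exact one_mem _

theorem PresOn.of_equiv {H K : Type*} [Group H] [Group K] (e : H ≃* K) {α : Type} {x : α → H}
    {R : Set (FreeGroup α)} (h : PresOn H α x R) : PresOn K α (fun a => e (x a)) R := by
  have h1 : FreeGroup.lift (fun a => e (x a)) = e.toMonoidHom.comp (FreeGroup.lift x) := by
    ext a; simp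
  refine ⟨?_, ?_⟩
  · rw [h1]; exact e.surjective.comp h.1
  · rw [h1, ← h.2]
    ext f; simp [MonoidHom.mem_ker]

/-- `(X ⊕ X → G) ≃* (X → G) × (X → G)`. -/
def sumPow (G X : Type*) [Group G] : (X → G) × (X → G) ≃* (X ⊕ X → G) where
  toFun f := Sum.elim f.1 f.2
  invFun f := (fun a => f (Sum.inl a), fun a => f (Sum.inr a))
  left_inv f := rfl
  right_inv f := by ext a; cases a <;> rfl
  map_mul' f g := by ext a; cases a <;> rfl

theorem powers {G : Type*} [Group G] (hG : SPerf G) {k l : ℕ} (x : Fin k → G)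
    (R : Set (FreeGroup (Fin k))) (hR : R.Finite) (hl : R.ncard ≤ l) (hP : PresOn G (Fin k) x R)
    (m : ℕ) : ∃ (X : Type) (_ : Finite X) (α : Type) (_ : Finite α) (y : α → X → G)
      (S : Set (FreeGroup α)), Nat.card X = 2 ^ m ∧ Nat.card α = k * (m + 1) ∧ S.Finite ∧
      S.ncard ≤ (l + k ^ 2 + k) * (m + 1) ^ 3 ∧ SPerf (X → G) ∧ PresOn (X → G) α y S := by
  have hu : Subgroup.normalClosure (Set.range x) = ⊤ := by
    rw [eq_top_iff]
    refine le_trans ?_ (Subgroup.closure_le_normalClosure)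
    rw [← FreeGroup.range_lift_eq_closure, MonoidHom.range_eq_top.2 hP.1]
  induction m with
  | zero =>
    let e : G ≃* (Unit → G) := (MulEquiv.funUnique Unit G).symm
    refine ⟨Unit, inferInstance, Fin k, inferInstance, _, R, by simp, by simp, hR, ?_,
      hG.of_equiv e, hP.of_equiv e⟩
    nlinarith
  | succ m ih =>
    obtain ⟨X, _, α, _, y, S, hX, hα, hS, hSl, hSP, hPr⟩ := ih
    obtain ⟨y', S', hS', hS'l, hPr'⟩ := doubling hSP hS hPr (fun s _ => x s) (by
      rw [eq_top_iff]
      intro f _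
      exact normal_gen hG.1 x hu Set.univ _ (fun _ _ _ => rfl) f (by simp))
    refine ⟨X ⊕ X, inferInstance, α ⊕ Fin k, inferInstance, _, S', ?_, ?_, hS', ?_,
      (hSP.prod hSP).of_equiv (sumPow G X), hPr'.of_equiv (sumPow G X)⟩
    · rw [Nat.card_sum, hX]; ring
    · rw [Nat.card_sum, hα, Nat.card_fin]; ring
    · rw [hα] at hS'l
      refine hS'l.trans ?_
      have h1 : (k * (m + 1)) ^ 2 + k ≤ (l + k ^ 2 + k) * (m + 1) ^ 2 := by nlinarith
      have h2 : (m + 1) ^ 3 + (m + 1) ^ 2 ≤ (m + 1 + 1) ^ 3 := by nlinarith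
      have h3 := Nat.mul_le_mul_left (l + k ^ 2 + k) h2
      linarith

theorem final_quot {G : Type*} [Group G] (hG : commutator G = ⊤) {c : ℕ} (u : Fin c → G)
    (hu : Subgroup.normalClosure (Set.range u) = ⊤) {X : Type} [Finite X] {n : ℕ}
    (hn : n ≤ Nat.card X) {α : Type} [Finite α] {y : α → X → G} {S : Set (FreeGroup α)}
    (hS : S.Finite) (hP : PresOn (X → G) α y S) :
    HasPresentationCard (Fin n → G) (Nat.card α) (S.ncard + c) := by
  classical
  let eX := Finite.equivFin X
  let j : Fin n → X := fun i => eX.symm (Fin.castLE hn i)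
  have hj : Function.Injective j := eX.symm.injective.comp (Fin.castLE_injective hn)
  let ρ : (X → G) →* (Fin n → G) :=
    { toFun := fun f i => f (j i), map_one' := rfl, map_mul' := fun _ _ => rfl }
  have hρ : Function.Surjective ρ := by
    intro f
    exact ⟨Function.extend j f 1, funext fun i => hj.extend_apply _ _ _⟩
  let t : Fin c → X → G := fun s a => if a ∈ Set.range j then 1 else u s
  choose v hv using fun s => hP.1 (t s)
  let eα := Finite.equivFin α
  let φ : FreeGroup (Fin (Nat.card α)) →* (X → G) := FreeGroup.lift (fun i => y (eα.symm i))
  let m := FreeGroup.freeGroupCongr eα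
  have hφ : ∀ f, φ (m f) = FreeGroup.lift y f := by
    intro f
    have : φ.comp m.toMonoidHom = FreeGroup.lift y := by ext a; simp [φ, m]
    exact DFunLike.congr_fun this f
  have key : (ρ.comp (FreeGroup.lift y)).ker = Subgroup.normalClosure (S ∪ Set.range v) := by
    apply le_antisymm
    · intro f hf
      have h1 : FreeGroup.lift y f ∈ Subgroup.normalClosure (Set.range t) := by
        refine normal_gen hG u hu (Set.range j)ᶜ t (fun s a ha => if_neg ha) _ ?_
        intro a ha
        rw [Set.notMem_compl_iff] at ha
        obtain ⟨i, rfl⟩ := ha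
        exact congrFun hf i
      have h2 : Subgroup.normalClosure (Set.range t) =
          Subgroup.map (FreeGroup.lift y) (Subgroup.normalClosure (Set.range v)) := by
        rw [Subgroup.map_normalClosure _ _ hP.1, ← Set.range_comp]
        congr 2
        ext s : 1; exact (hv s).symm
      rw [h2] at h1
      obtain ⟨g, hg, hgf⟩ := h1
      have h3 : f * g⁻¹ ∈ Subgroup.normalClosure S := by
        rw [← hP.2, MonoidHom.mem_ker, map_mul, map_inv, hgf, mul_inv_cancel]
      have h4 := mul_mem (Subgroup.normalClosure_mono Set.subset_union_left h3)
        (Subgroup.normalClosure_mono (Set.subset_union_right (s := S)) hg)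
      simpa using h4
    · apply Subgroup.normalClosure_le_normal
      rintro _ (hr | ⟨s, rfl⟩)
      · have := hP.2.symm ▸ Subgroup.subset_normalClosure hr
        rw [SetLike.mem_coe, MonoidHom.mem_ker] at this
        simp [MonoidHom.mem_ker, this]
      · change ρ (FreeGroup.lift y (v s)) = 1
        rw [hv]
        ext i
        exact if_pos ⟨i, rfl⟩
  refine ⟨ρ.comp φ, ?_, m '' (S ∪ Set.range v), ?_, ?_, ?_⟩
  · apply hρ.comp
    intro f
    obtain ⟨g, rfl⟩ := hP.1 f
    exact ⟨m g, hφ g⟩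
  · exact (hS.union (Set.finite_range v)).image _
  · refine (Set.ncard_image_le (hS.union (Set.finite_range v))).trans
      ((Set.ncard_union_le _ _).trans (Nat.add_le_add_left ?_ _))
    rw [← Set.image_univ]
    refine (Set.ncard_image_le Set.finite_univ).trans ?_
    rw [Set.ncard_univ, Nat.card_fin]
  · have h1 := Subgroup.map_normalClosure (S ∪ Set.range v) m.toMonoidHom m.surjective
    change _ = Subgroup.normalClosure (m.toMonoidHom '' (S ∪ Set.range v))
    rw [← h1, ← key]
    ext f
    obtain ⟨g, rfl⟩ := m.surjective f
    constructor
    · intro h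
      refine ⟨g, ?_, rfl⟩
      change ρ (FreeGroup.lift y g) = 1
      rw [← hφ]; exact h
    · rintro ⟨g', h, hh⟩
      have : g' = g := m.injective hh
      subst this
      change ρ (φ (m g')) = 1
      rw [hφ]; exact h

/-- If `G` is finitely presented with `H₁(G,ℤ) = H₂(G,ℤ) = 0`, then for `n ≥ 2`
the power `Gⁿ` has a presentation with at most `C·log n` generators and at most
`C·(log n)³` relators. -/
theorem stmt_2 (G : Type*) [Group G] (hFP : FinitelyPresented G)
    (hH1 : Subsingleton (Abelianization G)) (hH2 : Subsingleton (H2 G)) :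
    ∃ C : ℝ, 0 < C ∧ ∀ n : ℕ, 2 ≤ n → ∃ k l : ℕ,
      (k : ℝ) ≤ C * Real.log n ∧ (l : ℝ) ≤ C * Real.log n ^ 3 ∧
      HasPresentationCard (Fin n → G) k l := by
  obtain ⟨k, l, φ, hφ, R, hR, hRl, hker⟩ := hFP
  have hG := sPerf_of_H2 G hH1 hH2
  let x : Fin k → G := fun i => φ (FreeGroup.of i)
  have hx : FreeGroup.lift x = φ := by ext i; simp [x]
  have hP : PresOn G (Fin k) x R := by
    unfold PresOn; rw [hx]; exact ⟨hφ, hker⟩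
  have hu : Subgroup.normalClosure (Set.range x) = ⊤ := by
    rw [eq_top_iff]
    refine le_trans ?_ (Subgroup.closure_le_normalClosure)
    rw [← FreeGroup.range_lift_eq_closure, MonoidHom.range_eq_top.2 hP.1]
  refine ⟨6 * k + 432 * (l + k ^ 2 + k) + 1, by positivity, fun n hn => ?_⟩
  set m := Nat.log 2 n + 1 with hm
  obtain ⟨X, _, α, _, y, S, hX, hα, hS, hSl, -, hPr⟩ := powers hG x R hR hRl hP m
  have hnX : n ≤ Nat.card X := by
    rw [hX]; exact (Nat.lt_pow_succ_log_self (by norm_num) n).le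
  refine ⟨_, _, ?_, ?_, final_quot hG.1 x hu hnX hS hPr⟩
  all_goals
    have hlog : (m : ℝ) ≤ 3 * Real.log n := by
      have h1 : (2 : ℝ) ^ (Nat.log 2 n) ≤ n := by
        exact_mod_cast Nat.pow_log_le_self 2 (by omega)
      have h2 := Real.log_le_log (by positivity) h1
      rw [Real.log_pow] at h2
      have h3 : Real.log 2 ≤ Real.log n :=
        Real.log_le_log (by norm_num) (by exact_mod_cast hn)
      have h4 := Real.log_two_gt_d9
      rw [hm]; push_cast
      have h5 : (0 : ℝ) ≤ (Nat.log 2 n : ℝ) := by positivity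
      nlinarith
    have hm1 : (1 : ℝ) ≤ m := by rw [hm]; push_cast; linarith [(Nat.log 2 n).cast_nonneg (α := ℝ)]
    have hk0 : (0 : ℝ) ≤ k := by positivity
    have hl0 : (0 : ℝ) ≤ l := by positivity
    have hlog0 : 0 ≤ Real.log n := by linarith
  · rw [hα]; push_cast
    calc (k : ℝ) * (m + 1) ≤ k * (2 * m) := by gcongr; linarith
      _ ≤ k * (2 * (3 * Real.log n)) := by gcongr
      _ = (6 * k) * Real.log n := by ring
      _ ≤ _ := by
        gcongr
        have : (0 : ℝ) ≤ 432 * (l + k ^ 2 + k) := by positivity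
        linarith
  · have h1 : ((S.ncard + k : ℕ) : ℝ) ≤ (l + k ^ 2 + k) * (m + 1) ^ 3 + k := by
      exact_mod_cast Nat.add_le_add_right hSl k
    have h2 : (1 : ℝ) ≤ (m + 1) ^ 3 := one_le_pow₀ (by linarith)
    have h3 : (k : ℝ) ≤ (l + k ^ 2 + k) * (m + 1) ^ 3 := by
      have : (k : ℝ) ≤ l + k ^ 2 + k := by nlinarith
      nlinarith
    calc ((S.ncard + k : ℕ) : ℝ) ≤ 2 * (l + k ^ 2 + k) * (m + 1) ^ 3 := by linarith
      _ ≤ 2 * (l + k ^ 2 + k) * (2 * m) ^ 3 := by gcongr; linarith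
      _ ≤ 2 * (l + k ^ 2 + k) * (2 * (3 * Real.log n)) ^ 3 := by gcongr
      _ = (432 * (l + k ^ 2 + k)) * Real.log n ^ 3 := by ring
      _ ≤ _ := by
        gcongr
        linarith
end

section
/- Let G be a finitely presented group with H_1(G,ℤ) = 0 and H_2(G,ℤ) = 0, and suppose G admits a non-trivial finite quotient. Then there exist positive constants c, C, c₀, c₁ such that for all integers n ≥ 2 one has c·log n ≤ d(Gⁿ) ≤ C·log n and c₀·log n ≤ ρ(Gⁿ) ≤ c₁·(log n)³. -/
namespace Powers

open scoped commutatorElement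

universe u

/-- A group all of whose central extensions have kernel meeting the commutator subgroup trivially. -/
def SP (Γ : Type u) [Group Γ] : Prop :=
  ∀ (E : Type) [Group E] (π : E →* Γ), Function.Surjective π → π.ker ≤ Subgroup.center E →
    ∀ z ∈ commutator E, π z = 1 → z = 1

theorem comm_central {E : Type*} [Group E] {z w : E} (hz : z ∈ Subgroup.center E)
    (hw : w ∈ Subgroup.center E) (a b : E) : ⁅a * z, b * w⁆ = ⁅a, b⁆ := by
  have hz' : ∀ g, g * z = z * g := Subgroup.mem_center_iff.1 hz
  have hw' : ∀ g, g * w = w * g := Subgroup.mem_center_iff.1 hw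
  simp only [commutatorElement_def]
  rw [mul_inv_rev, mul_inv_rev]
  calc a * z * (b * w) * (z⁻¹ * a⁻¹) * (w⁻¹ * b⁻¹)
      = a * (z * (b * w)) * z⁻¹ * a⁻¹ * w⁻¹ * b⁻¹ := by group
    _ = a * b * (w * a⁻¹) * w⁻¹ * b⁻¹ := by rw [← hz']; group
    _ = a * b * a⁻¹ * b⁻¹ := by rw [← hw']; group

theorem sp_of_H2 (G : Type u) [Group G] (hH2 : Subsingleton (H2 G)) : SP G := by
  have hop : freeKernel G ⊓ commutator (FreeGroup G) ≤
      ⁅(⊤ : Subgroup (FreeGroup G)), freeKernel G⁆ :=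
    Subgroup.subgroupOf_eq_top.1 (QuotientGroup.subgroup_eq_top_of_subsingleton _ hH2)
  intro E _ π hs hc z hz hz1
  choose s hs using hs
  let f : FreeGroup G →* E := FreeGroup.lift s
  have hf : π.comp f = FreeGroup.lift id := by
    ext g; simp [f, hs]
  have hf' : ∀ w, π (f w) = FreeGroup.lift id w := fun w => DFunLike.congr_fun hf w
  have key : commutator E ≤ (commutator (FreeGroup G)).map f := by
    rw [commutator_def, Subgroup.commutator_le]
    intro a _ b _
    have h1 : ∀ a : E, ∃ x, ∃ z ∈ Subgroup.center E, a = f x * z := by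
      intro a
      refine ⟨FreeGroup.of (π a), (f (FreeGroup.of (π a)))⁻¹ * a, hc ?_, by group⟩
      simp [MonoidHom.mem_ker, hf']
    obtain ⟨x, c, hc1, rfl⟩ := h1 a
    obtain ⟨y, d, hd1, rfl⟩ := h1 b
    rw [comm_central hc1 hd1]
    refine ⟨⁅x, y⁆, ?_, map_commutatorElement f x y⟩
    exact Subgroup.commutator_mem_commutator (Subgroup.mem_top _) (Subgroup.mem_top _)
  obtain ⟨w, hw, rfl⟩ := key hz
  have h2 : ⁅(⊤ : Subgroup (FreeGroup G)), freeKernel G⁆ ≤ f.ker := by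
    rw [Subgroup.commutator_le]
    intro a _ r hr
    rw [MonoidHom.mem_ker, map_commutatorElement, commutatorElement_eq_one_iff_mul_comm]
    refine Subgroup.mem_center_iff.1 (hc ?_) _
    rw [MonoidHom.mem_ker, hf']
    exact hr
  refine h2 (hop ⟨?_, hw⟩)
  rw [hf'] at hz1
  exact hz1

theorem sp_equiv {Γ Δ : Type u} [Group Γ] [Group Δ] (e : Γ ≃* Δ) (h : SP Γ) : SP Δ := by
  intro E _ π hs hc z hz hz1
  refine h E (e.symm.toMonoidHom.comp π) (e.symm.surjective.comp hs) ?_ z hz (by simp [hz1])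
  intro x hx
  apply hc
  simpa [MonoidHom.mem_ker] using hx

theorem sp_prod {Γ Δ : Type u} [Group Γ] [Group Δ] (h : SP Γ) (h' : SP Δ)
    (p : commutator Γ = ⊤) (p' : commutator Δ = ⊤) : SP (Γ × Δ) := by
  intro E _ π hs hc z hz hz1
  let P1 : Subgroup E := ((MonoidHom.snd Γ Δ).comp π).ker
  let P2 : Subgroup E := ((MonoidHom.fst Γ Δ).comp π).ker
  have m1 : P1.map π = Subgroup.prod ⊤ ⊥ := by
    ext ⟨a, b⟩
    simp only [Subgroup.mem_map, Subgroup.mem_prod, Subgroup.mem_top, true_and, Subgroup.mem_bot]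
    constructor
    · rintro ⟨x, hx, hx'⟩
      have : (π x).2 = 1 := hx
      rw [hx'] at this
      exact this
    · rintro rfl
      obtain ⟨x, hx⟩ := hs (a, 1)
      exact ⟨x, by simp [P1, MonoidHom.mem_ker, hx], hx⟩
  have m2 : P2.map π = Subgroup.prod ⊥ ⊤ := by
    ext ⟨a, b⟩
    simp only [Subgroup.mem_map, Subgroup.mem_prod, Subgroup.mem_top, and_true, Subgroup.mem_bot]
    constructor
    · rintro ⟨x, hx, hx'⟩
      have : (π x).1 = 1 := hx
      rw [hx'] at this
      exact this
    · rintro rfl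
      obtain ⟨x, hx⟩ := hs (1, b)
      exact ⟨x, by simp [P2, MonoidHom.mem_ker, hx], hx⟩
  have c1 : (⁅P1, P1⁆).map π = Subgroup.prod ⊤ ⊥ := by
    rw [Subgroup.map_commutator, m1, Subgroup.commutator_prod_prod, ← commutator_def, p]
    simp
  have c2 : (⁅P2, P2⁆).map π = Subgroup.prod ⊥ ⊤ := by
    rw [Subgroup.map_commutator, m2, Subgroup.commutator_prod_prod, ← commutator_def, p']
    simp
  have key : commutator E ≤ ⁅P1, P1⁆ ⊔ ⁅P2, P2⁆ := by
    rw [commutator_def, Subgroup.commutator_le]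
    intro a _ b _
    have h1 : ∀ a : E, ∃ x ∈ ⁅P1, P1⁆ ⊔ ⁅P2, P2⁆, ∃ z ∈ Subgroup.center E, a = x * z := by
      intro a
      have q1 : ((π a).1, (1 : Δ)) ∈ (⁅P1, P1⁆).map π := by rw [c1]; simp [Subgroup.mem_prod]
      have q2 : ((1 : Γ), (π a).2) ∈ (⁅P2, P2⁆).map π := by rw [c2]; simp [Subgroup.mem_prod]
      obtain ⟨x, hx, hx'⟩ := q1
      obtain ⟨y, hy, hy'⟩ := q2
      refine ⟨x * y, mul_mem (Subgroup.mem_sup_left hx) (Subgroup.mem_sup_right hy),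
        (x * y)⁻¹ * a, hc ?_, by group⟩
      rw [MonoidHom.mem_ker, map_mul, map_inv, map_mul, hx', hy', inv_mul_eq_one]
      ext <;> simp
    obtain ⟨x, hx, c, hc1, rfl⟩ := h1 a
    obtain ⟨y, hy, d, hd1, rfl⟩ := h1 b
    rw [comm_central hc1 hd1, commutatorElement_def]
    exact mul_mem (mul_mem (mul_mem hx hy) (inv_mem hx)) (inv_mem hy)
  obtain ⟨a, ha, b, hb, rfl⟩ := Subgroup.mem_sup_of_normal_right.1 (key hz)
  have ha2 : (π a).2 = 1 := by
    have : π a ∈ (⁅P1, P1⁆).map π := ⟨a, ha, rfl⟩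
    rw [c1] at this
    exact this.2
  have hb2 : (π b).1 = 1 := by
    have : π b ∈ (⁅P2, P2⁆).map π := ⟨b, hb, rfl⟩
    rw [c2] at this
    exact this.1
  have ha1 : (π a).1 = 1 := by
    have := congrArg Prod.fst hz1
    simpa [hb2] using this
  have hb1 : (π b).2 = 1 := by
    have := congrArg Prod.snd hz1
    simpa [ha2] using this
  have A : a = 1 := by
    rw [← Subgroup.map_subtype_commutator] at ha
    obtain ⟨a', ha', rfl⟩ := ha
    have := h P1 (((MonoidHom.fst Γ Δ).comp π).comp P1.subtype) ?_ ?_ a' ha' ha1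
    · rw [this]; simp
    · intro g
      have : (g, (1 : Δ)) ∈ P1.map π := by rw [m1]; simp [Subgroup.mem_prod]
      obtain ⟨x, hx, hx'⟩ := this
      exact ⟨⟨x, hx⟩, by simp [hx']⟩
    · intro x hx
      have hx1 : (π x).1 = 1 := hx
      have hx2 : (π x).2 = 1 := x.2
      have := hc (show (x : E) ∈ π.ker from Prod.ext hx1 hx2)
      rw [Subgroup.mem_center_iff] at this ⊢
      intro g
      exact Subtype.ext (this g)
  have B : b = 1 := by
    rw [← Subgroup.map_subtype_commutator] at hb
    obtain ⟨b', hb', rfl⟩ := hb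
    have := h' P2 (((MonoidHom.snd Γ Δ).comp π).comp P2.subtype) ?_ ?_ b' hb' hb1
    · rw [this]; simp
    · intro g
      have : ((1 : Γ), g) ∈ P2.map π := by rw [m2]; simp [Subgroup.mem_prod]
      obtain ⟨x, hx, hx'⟩ := this
      exact ⟨⟨x, hx⟩, by simp [hx']⟩
    · intro x hx
      have hx1 : (π x).2 = 1 := hx
      have hx2 : (π x).1 = 1 := x.2
      have := hc (show (x : E) ∈ π.ker from Prod.ext hx2 hx1)
      rw [Subgroup.mem_center_iff] at this ⊢
      intro g
      exact Subtype.ext (this g)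
  rw [A, B, mul_one]

/-- Hopf-type consequence for an arbitrary free presentation. -/
theorem sp_hopf {Γ : Type u} [Group Γ] (h : SP Γ) {F : Type} [Group F] (φ : F →* Γ)
    (hφ : Function.Surjective φ) : φ.ker ⊓ commutator F ≤ ⁅(⊤ : Subgroup F), φ.ker⁆ := by
  rintro w ⟨hw1, hw2⟩
  have hle : ⁅(⊤ : Subgroup F), φ.ker⁆ ≤ φ.ker := Subgroup.commutator_le_right _ _
  have := h (F ⧸ ⁅(⊤ : Subgroup F), φ.ker⁆) (QuotientGroup.lift _ φ hle) ?_ ?_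
    (QuotientGroup.mk' _ w) ?_ ?_
  · exact (QuotientGroup.eq_one_iff w).1 this
  · intro g
    obtain ⟨x, rfl⟩ := hφ g
    exact ⟨QuotientGroup.mk' _ x, rfl⟩
  · intro x
    refine QuotientGroup.induction_on x ?_
    intro x hx
    rw [Subgroup.mem_center_iff]
    intro g
    refine QuotientGroup.induction_on g ?_
    intro g
    have hx' : x ∈ φ.ker := hx
    have := Subgroup.commutator_mem_commutator (Subgroup.mem_top g) hx'
    rw [← commutatorElement_eq_one_iff_mul_comm]
    exact (QuotientGroup.eq_one_iff _).2 this
  · have : Subgroup.map (QuotientGroup.mk' ⁅(⊤ : Subgroup F), φ.ker⁆) (commutator F) ≤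
        commutator _ := by
      rw [commutator_def, Subgroup.map_commutator, commutator_def]
      exact Subgroup.commutator_mono le_top le_top
    exact this ⟨w, hw2, rfl⟩
  · exact hw1

/-- Presentation on an arbitrary generating type. -/
def Pres (Γ : Type*) [Group Γ] (α : Type) (l : ℕ) : Prop :=
  ∃ φ : FreeGroup α →* Γ, Function.Surjective φ ∧
    ∃ R : Set (FreeGroup α), R.Finite ∧ R.ncard ≤ l ∧
      φ.ker = Subgroup.normalClosure R

theorem ncard_range_le {ι α : Type*} [Fintype ι] (f : ι → α) :
    (Set.range f).ncard ≤ Fintype.card ι := by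
  rw [← Set.image_univ]
  refine (Set.ncard_image_le Set.finite_univ).trans ?_
  rw [Set.ncard_univ, Nat.card_eq_fintype_card]

theorem change_gens {Γ Γ' : Type*} [Group Γ] [Group Γ'] {α : Type} {l d : ℕ}
    (h : Pres Γ α l) (e : Γ ≃* Γ') (θ : FreeGroup (Fin d) →* Γ') (hθ : Function.Surjective θ) :
    HasPresentationCard Γ' d (l + d) := by
  obtain ⟨φ, hφ, R, hfin, hcard, hker⟩ := h
  choose w hw using fun a : α => hθ (e (φ (FreeGroup.of a)))
  choose u hu using fun j : Fin d => hφ (e.symm (θ (FreeGroup.of j)))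
  let W : FreeGroup α →* FreeGroup (Fin d) := FreeGroup.lift w
  let U : FreeGroup (Fin d) →* FreeGroup α := FreeGroup.lift u
  have hW : ∀ x, θ (W x) = e (φ x) := by
    have : θ.comp W = e.toMonoidHom.comp φ := by ext a; simp [W, hw]
    exact fun x => DFunLike.congr_fun this x
  have hU : ∀ x, φ (U x) = e.symm (θ x) := by
    have : φ.comp U = e.symm.toMonoidHom.comp θ := by ext a; simp [U, hu]
    exact fun x => DFunLike.congr_fun this x
  refine ⟨θ, hθ, W '' R ∪ Set.range (fun j => FreeGroup.of j * (W (u j))⁻¹),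
    (hfin.image _).union (Set.finite_range _), ?_, ?_⟩
  · refine (Set.ncard_union_le _ _).trans (add_le_add ((Set.ncard_image_le hfin).trans hcard) ?_)
    simpa using ncard_range_le (fun j => FreeGroup.of j * (W (u j))⁻¹)
  · set R' := W '' R ∪ Set.range (fun j => FreeGroup.of j * (W (u j))⁻¹) with hR'
    apply le_antisymm
    · intro x hx
      have h1 : U x ∈ Subgroup.normalClosure R := by
        rw [← hker, MonoidHom.mem_ker, hU, MonoidHom.mem_ker.1 hx, map_one]
      have h2 : Subgroup.normalClosure R ≤ (Subgroup.normalClosure R').comap W := by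
        apply Subgroup.normalClosure_le_normal
        intro r hr
        exact Subgroup.subset_normalClosure (Or.inl ⟨r, hr, rfl⟩)
      have h3 := h2 h1
      rw [Subgroup.mem_comap] at h3
      have h4 : (QuotientGroup.mk' (Subgroup.normalClosure R')).comp (W.comp U) =
          QuotientGroup.mk' (Subgroup.normalClosure R') := by
        ext j
        have : FreeGroup.of j * (W (u j))⁻¹ ∈ Subgroup.normalClosure R' :=
          Subgroup.subset_normalClosure (Or.inr ⟨j, rfl⟩)
        have := (QuotientGroup.eq_one_iff _).2 this
        rw [QuotientGroup.mk_mul, QuotientGroup.mk_inv, mul_inv_eq_one] at this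
        simp [U, this]
      rw [← QuotientGroup.eq_one_iff] at h3 ⊢
      rw [← h3]
      exact (DFunLike.congr_fun h4 x).symm
    · apply Subgroup.normalClosure_le_normal
      rintro x (⟨r, hr, rfl⟩ | ⟨j, rfl⟩)
      · have : r ∈ φ.ker := by rw [hker]; exact Subgroup.subset_normalClosure hr
        simp only [SetLike.mem_coe, MonoidHom.mem_ker]
        rw [hW, MonoidHom.mem_ker.1 this, map_one]
      · simp only [SetLike.mem_coe, MonoidHom.mem_ker]
        rw [map_mul, map_inv, hW, hu]
        simp

theorem kill {Γ Δ : Type*} [Group Γ] [Group Δ] {k l d : ℕ} (h : HasPresentationCard Γ k l)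
    (p : Γ →* Δ) (hp : Function.Surjective p) (t : Fin d → Γ)
    (ht : p.ker = Subgroup.closure (Set.range t)) : HasPresentationCard Δ k (l + d) := by
  obtain ⟨φ, hφ, R, hfin, hcard, hker⟩ := h
  choose u hu using fun j : Fin d => hφ (t j)
  refine ⟨p.comp φ, hp.comp hφ, R ∪ Set.range u, hfin.union (Set.finite_range _), ?_, ?_⟩
  · refine (Set.ncard_union_le _ _).trans (add_le_add hcard ?_)
    simpa using ncard_range_le u
  · apply le_antisymm
    · intro x hx
      have h1 : φ x ∈ p.ker := hx
      have h2 : Subgroup.closure (Set.range t) ≤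
          (Subgroup.normalClosure (R ∪ Set.range u)).map φ := by
        rw [Subgroup.closure_le]
        rintro _ ⟨j, rfl⟩
        exact ⟨u j, Subgroup.subset_normalClosure (Or.inr ⟨j, rfl⟩), hu j⟩
      rw [ht] at h1
      obtain ⟨y, hy, hyx⟩ := h2 h1
      have h3 : x * y⁻¹ ∈ φ.ker := by
        rw [MonoidHom.mem_ker, map_mul, map_inv, hyx, mul_inv_cancel]
      rw [hker] at h3
      have h4 := Subgroup.normalClosure_mono (Set.subset_union_left (t := Set.range u)) h3
      simpa using mul_mem h4 hy
    · apply Subgroup.normalClosure_le_normal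
      rintro x (hr | ⟨j, rfl⟩)
      · have : x ∈ φ.ker := by rw [hker]; exact Subgroup.subset_normalClosure hr
        simp [MonoidHom.mem_ker, MonoidHom.mem_ker.1 this]
      · have : t j ∈ p.ker := by rw [ht]; exact Subgroup.subset_closure ⟨j, rfl⟩
        simpa [MonoidHom.mem_ker, hu] using this

theorem double {Γ : Type u} [Group Γ] {k l : ℕ} (h : HasPresentationCard Γ k l) (sp : SP Γ)
    (pf : commutator Γ = ⊤) : Pres (Γ × Γ) (Fin k ⊕ Fin k) (k * k + l + k) := by
  obtain ⟨φ₀, hφ, R₀, hfin, hcard, hker⟩ := h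
  have hop := sp_hopf sp φ₀ hφ
  let i₁ : FreeGroup (Fin k) →* FreeGroup (Fin k ⊕ Fin k) := FreeGroup.map Sum.inl
  let i₂ : FreeGroup (Fin k) →* FreeGroup (Fin k ⊕ Fin k) := FreeGroup.map Sum.inr
  let p₁ : FreeGroup (Fin k ⊕ Fin k) →* FreeGroup (Fin k) :=
    FreeGroup.lift (Sum.elim FreeGroup.of (fun _ => 1))
  let p₂ : FreeGroup (Fin k ⊕ Fin k) →* FreeGroup (Fin k) :=
    FreeGroup.lift (Sum.elim (fun _ => 1) FreeGroup.of)
  have p11 : ∀ x, p₁ (i₁ x) = x := by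
    have : p₁.comp i₁ = MonoidHom.id _ := by ext; simp [p₁, i₁]
    exact fun x => DFunLike.congr_fun this x
  have p22 : ∀ x, p₂ (i₂ x) = x := by
    have : p₂.comp i₂ = MonoidHom.id _ := by ext; simp [p₂, i₂]
    exact fun x => DFunLike.congr_fun this x
  have p12 : ∀ x, p₁ (i₂ x) = 1 := by
    have : p₁.comp i₂ = 1 := by ext; simp [p₁, i₂]
    exact fun x => DFunLike.congr_fun this x
  have p21 : ∀ x, p₂ (i₁ x) = 1 := by
    have : p₂.comp i₁ = 1 := by ext; simp [p₂, i₁]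
    exact fun x => DFunLike.congr_fun this x
  let φ : FreeGroup (Fin k ⊕ Fin k) →* Γ × Γ := (φ₀.comp p₁).prod (φ₀.comp p₂)
  have hc : ∀ i : Fin k, ∃ c ∈ commutator (FreeGroup (Fin k)), φ₀ c = φ₀ (FreeGroup.of i) := by
    intro i
    have : φ₀ (FreeGroup.of i) ∈ (commutator (FreeGroup (Fin k))).map φ₀ := by
      rw [commutator_def, Subgroup.map_commutator, ← MonoidHom.range_eq_map,
        MonoidHom.range_eq_top.2 hφ, ← commutator_def, pf]
      trivial
    exact this
  choose c hc hc' using hc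
  let R1 : Set (FreeGroup (Fin k ⊕ Fin k)) := Set.range
    (fun p : Fin k × Fin k => ⁅i₁ (FreeGroup.of p.1), i₂ (FreeGroup.of p.2)⁆)
  let R2 : Set (FreeGroup (Fin k ⊕ Fin k)) := (fun r => i₁ r * i₂ r) '' R₀
  let R3 : Set (FreeGroup (Fin k ⊕ Fin k)) := Set.range
    (fun i : Fin k => i₁ (FreeGroup.of i * (c i)⁻¹))
  have hM : ∀ r ∈ R₀, φ₀ r = 1 := by
    intro r hr
    have : r ∈ φ₀.ker := by rw [hker]; exact Subgroup.subset_normalClosure hr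
    exact this
  refine ⟨φ, ?_, R1 ∪ R2 ∪ R3,
    ((Set.finite_range _).union (hfin.image _)).union (Set.finite_range _), ?_, ?_⟩
  · rintro ⟨a, b⟩
    obtain ⟨x, rfl⟩ := hφ a
    obtain ⟨y, rfl⟩ := hφ b
    exact ⟨i₁ x * i₂ y, by simp [φ, p11, p12, p21, p22]⟩
  · refine (Set.ncard_union_le _ _).trans (add_le_add ((Set.ncard_union_le _ _).trans
      (add_le_add ?_ ((Set.ncard_image_le hfin).trans hcard))) ?_)
    · refine (ncard_range_le _).trans ?_
      simp
    · refine (ncard_range_le _).trans ?_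
      simp
  · apply le_antisymm
    · set N := Subgroup.normalClosure (R1 ∪ R2 ∪ R3) with hN
      let q := QuotientGroup.mk' N
      have hq : ∀ x ∈ R1 ∪ R2 ∪ R3, q x = 1 := fun x hx =>
        (QuotientGroup.eq_one_iff x).2 (Subgroup.subset_normalClosure hx)
      let j₁ := q.comp i₁
      let j₂ := q.comp i₂
      have comm : ∀ a b, Commute (j₁ a) (j₂ b) := by
        have c0 : ∀ a b, Commute (j₁ (FreeGroup.of a)) (j₂ (FreeGroup.of b)) := by
          intro a b
          have := hq _ (Or.inl (Or.inl ⟨(a, b), rfl⟩))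
          rw [map_commutatorElement, commutatorElement_eq_one_iff_commute] at this
          exact this
        have c1 : ∀ a b, Commute (j₁ (FreeGroup.of a)) (j₂ b) := by
          intro a b
          induction b using FreeGroup.induction_on with
          | C1 => rw [map_one]; exact Commute.one_right _
          | of b => exact c0 a b
          | inv_of b hb => rw [map_inv]; exact hb.inv_right
          | mul x y hx hy => rw [map_mul]; exact hx.mul_right hy
        intro a b
        induction a using FreeGroup.induction_on with
        | C1 => rw [map_one]; exact Commute.one_left _
        | of a => exact c1 a b
        | inv_of b hb => rw [map_inv]; exact hb.inv_left
        | mul x y hx hy => rw [map_mul]; exact hx.mul_left hy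
      have r12 : ∀ r ∈ R₀, j₁ r = (j₂ r)⁻¹ := by
        intro r hr
        have := hq _ (Or.inl (Or.inr ⟨r, hr, rfl⟩))
        rw [map_mul] at this
        exact eq_inv_of_mul_eq_one_left this
      have cen : φ₀.ker ≤ (Subgroup.center j₁.range).comap j₁.rangeRestrict := by
        rw [hker]
        apply Subgroup.normalClosure_le_normal
        intro r hr
        simp only [SetLike.mem_coe, Subgroup.mem_comap, Subgroup.mem_center_iff]
        rintro ⟨_, a, rfl⟩
        apply Subtype.ext
        change j₁ a * j₁ r = j₁ r * j₁ a
        rw [r12 r hr]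
        exact (comm a r).inv_right
      have cen' : ∀ s ∈ φ₀.ker, ∀ a, j₁ a * j₁ s = j₁ s * j₁ a := by
        intro s hs a
        have := Subgroup.mem_center_iff.1 (cen hs) (j₁.rangeRestrict a)
        exact congrArg Subtype.val this
      have hcomm : ⁅(⊤ : Subgroup (FreeGroup (Fin k))), φ₀.ker⁆ ≤ j₁.ker := by
        rw [Subgroup.commutator_le]
        intro a _ s hs
        rw [MonoidHom.mem_ker, map_commutatorElement, commutatorElement_eq_one_iff_mul_comm]
        exact cen' s hs a
      have htop : commutator (FreeGroup (Fin k)) ⊔ (j₁.ker ⊓ φ₀.ker) = ⊤ := by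
        rw [eq_top_iff, ← FreeGroup.closure_range_of, Subgroup.closure_le]
        rintro _ ⟨i, rfl⟩
        have h1 : FreeGroup.of i * (c i)⁻¹ ∈ j₁.ker ⊓ φ₀.ker :=
          ⟨hq _ (Or.inr ⟨i, rfl⟩), by simp [MonoidHom.mem_ker, hc']⟩
        have := mul_mem (Subgroup.mem_sup_right (S := commutator (FreeGroup (Fin k))) h1)
          (Subgroup.mem_sup_left (hc i))
        simpa using this
      have k1 : φ₀.ker ≤ j₁.ker := by
        intro r hr
        have : r ∈ commutator (FreeGroup (Fin k)) ⊔ (j₁.ker ⊓ φ₀.ker) := by rw [htop]; trivial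
        obtain ⟨a, ha, v, hv, rfl⟩ := Subgroup.mem_sup_of_normal_right.1 this
        have ha' : a ∈ φ₀.ker := (Subgroup.mul_mem_cancel_right _ hv.2).1 hr
        exact mul_mem (hcomm (hop ⟨ha', ha⟩)) hv.1
      have k2 : φ₀.ker ≤ j₂.ker := by
        rw [hker]
        apply Subgroup.normalClosure_le_normal
        intro r hr
        have h1 : j₁ r = 1 := k1 (hM r hr)
        rw [r12 r hr, inv_eq_one] at h1
        exact h1
      have fac : (MonoidHom.noncommCoprod j₁ j₂ comm).comp (p₁.prod p₂) = q := by
        ext i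
        rcases i with i | i
        · simp [p₁, p₂, j₁, i₁]
        · simp [p₁, p₂, j₂, i₂]
      intro w hw
      have hw1 : φ₀ (p₁ w) = 1 := congrArg Prod.fst (MonoidHom.mem_ker.1 hw)
      have hw2 : φ₀ (p₂ w) = 1 := congrArg Prod.snd (MonoidHom.mem_ker.1 hw)
      rw [← QuotientGroup.eq_one_iff]
      change q w = 1
      rw [← fac]
      change j₁ (p₁ w) * j₂ (p₂ w) = 1
      rw [show j₁ (p₁ w) = 1 from k1 hw1, show j₂ (p₂ w) = 1 from k2 hw2, mul_one]
    · apply Subgroup.normalClosure_le_normal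
      rintro x ((⟨p, rfl⟩ | ⟨r, hr, rfl⟩) | ⟨i, rfl⟩)
      · simp only [SetLike.mem_coe, MonoidHom.mem_ker]
        rw [map_commutatorElement, commutatorElement_eq_one_iff_mul_comm]
        simp [φ, p11, p12, p21, p22]
      · simp [MonoidHom.mem_ker, φ, p11, p12, p21, p22, hM r hr]
      · simp [MonoidHom.mem_ker, φ, p11, p12, p21, p22, hc']

end Powers

namespace Powers

open scoped commutatorElement

open Classical in
/-- Copy of `G` supported diagonally on the coordinates in `A`. -/
noncomputable def ind {G : Type*} [Group G] {ι : Type*} (A : Set ι) : G →* (ι → G) where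
  toFun g := fun x => if x ∈ A then g else 1
  map_one' := by ext; simp
  map_mul' a b := by ext x; by_cases h : x ∈ A <;> simp [h]

theorem ind_mem {G : Type*} [Group G] {ι : Type*} {A : Set ι} {x : ι} (h : x ∈ A) (g : G) :
    ind A g x = g := by simp [ind, h]

theorem ind_notMem {G : Type*} [Group G] {ι : Type*} {A : Set ι} {x : ι} (h : x ∉ A) (g : G) :
    ind A g x = 1 := by simp [ind, h]

theorem good_inter {G : Type*} [Group G] (pf : commutator G = ⊤) {ι : Type*}
    (H : Subgroup (ι → G)) {A B : Set ι} (hA : ∀ g, ind A g ∈ H) (hB : ∀ g, ind B g ∈ H) :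
    ∀ g, ind (A ∩ B) g ∈ H := by
  have : commutator G ≤ H.comap (ind (A ∩ B)) := by
    rw [commutator_def, Subgroup.commutator_le]
    intro a _ b _
    rw [Subgroup.mem_comap]
    have h1 : ind (A ∩ B) ⁅a, b⁆ = ⁅ind A a, ind B b⁆ := by
      ext x
      by_cases h1 : x ∈ A <;> by_cases h2 : x ∈ B <;>
        simp [commutatorElement_def, ind, h1, h2]
    rw [h1, commutatorElement_def]
    exact mul_mem (mul_mem (mul_mem (hA a) (hB b)) (inv_mem (hA a))) (inv_mem (hB b))
  intro g
  exact this (by rw [pf]; trivial)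

theorem good_compl {G : Type*} [Group G] {ι : Type*}
    (H : Subgroup (ι → G)) {A : Set ι} (hA : ∀ g, ind A g ∈ H) (hU : ∀ g, ind Set.univ g ∈ H) :
    ∀ g, ind Aᶜ g ∈ H := by
  intro g
  have : ind Aᶜ g = ind Set.univ g * (ind A g)⁻¹ := by
    ext x
    by_cases h1 : x ∈ A <;> simp [ind, h1]
  rw [this]
  exact mul_mem (hU g) (inv_mem (hA g))

theorem gen_pow {G : Type*} [Group G] (pf : commutator G = ⊤) {m : ℕ} (g : Fin m → G)
    (hg : Subgroup.closure (Set.range g) = ⊤) {n K : ℕ} (hn : n ≤ 2 ^ K) :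
    ∃ t : Fin (m * (K + 1)) → (Fin n → G), Subgroup.closure (Set.range t) = ⊤ := by
  let B : ℕ → Set (Fin n) := fun j => {x | j = K ∨ (x : ℕ).testBit j = true}
  let s : Fin m × Fin (K + 1) → (Fin n → G) := fun p => ind (B p.2) (g p.1)
  refine ⟨fun i => s (finProdFinEquiv.symm i), ?_⟩
  have hr : Set.range (fun i => s (finProdFinEquiv.symm i)) = Set.range s :=
    finProdFinEquiv.symm.surjective.range_comp s
  rw [hr]
  set H := Subgroup.closure (Set.range s) with hH
  have hB : ∀ j ≤ K, ∀ a, ind (B j) a ∈ H := by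
    intro j hj
    have : Subgroup.closure (Set.range g) ≤ H.comap (ind (B j)) := by
      rw [Subgroup.closure_le]
      rintro _ ⟨i, rfl⟩
      exact Subgroup.subset_closure ⟨(i, ⟨j, by omega⟩), rfl⟩
    intro a
    exact this (by rw [hg]; trivial)
  have hU : ∀ a, ind (Set.univ : Set (Fin n)) a ∈ H := by
    have : B K = Set.univ := by ext; simp [B]
    rw [← this]
    exact hB K le_rfl
  have hx : ∀ x : Fin n, ∀ J ≤ K, ∀ a,
      ind {y : Fin n | ∀ j < J, (y : ℕ).testBit j = (x : ℕ).testBit j} a ∈ H := by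
    intro x J
    induction J with
    | zero => intro _; simpa using hU
    | succ J ih =>
      intro hJ
      have ih := ih (by omega)
      have hBJ := hB J (by omega)
      by_cases hb : (x : ℕ).testBit J = true
      · have : {y : Fin n | ∀ j < J + 1, (y : ℕ).testBit j = (x : ℕ).testBit j} =
            {y : Fin n | ∀ j < J, (y : ℕ).testBit j = (x : ℕ).testBit j} ∩ B J := by
          ext y
          simp only [Set.mem_setOf_eq, Set.mem_inter_iff, B, Nat.forall_lt_succ_right, hb]
          have : J ≠ K := by omega
          simp [this]
        rw [this]
        exact good_inter pf H ih hBJ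
      · have : {y : Fin n | ∀ j < J + 1, (y : ℕ).testBit j = (x : ℕ).testBit j} =
            {y : Fin n | ∀ j < J, (y : ℕ).testBit j = (x : ℕ).testBit j} ∩ (B J)ᶜ := by
          ext y
          simp only [Set.mem_setOf_eq, Set.mem_inter_iff, B, Nat.forall_lt_succ_right, hb,
            Set.mem_compl_iff]
          have : J ≠ K := by omega
          simp [this]
        rw [this]
        exact good_inter pf H ih (good_compl H hBJ hU)
  have hsing : ∀ (x : Fin n) a, Pi.mulSingle x a ∈ H := by
    intro x a
    have e : {y : Fin n | ∀ j < K, (y : ℕ).testBit j = (x : ℕ).testBit j} = {x} := by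
      ext y
      simp only [Set.mem_setOf_eq, Set.mem_singleton_iff]
      refine ⟨fun h => Fin.ext (Nat.eq_of_testBit_eq fun j => ?_), fun h => by simp [h]⟩
      by_cases hj : j < K
      · exact h j hj
      · have hp : 2 ^ K ≤ 2 ^ j := Nat.pow_le_pow_right (by norm_num) (by omega)
        rw [Nat.testBit_lt_two_pow (by have := y.2; omega),
          Nat.testBit_lt_two_pow (by have := x.2; omega)]
    have h1 := hx x K le_rfl a
    rw [e] at h1
    convert h1 using 1
    ext y
    by_cases h : y = x
    · subst h; simp [ind]
    · simp [ind, h]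
  rw [eq_top_iff]
  intro f _
  exact Subgroup.pi_mem_of_mulSingle_mem f (fun i => hsing i (f i))

theorem lift_surj {Γ : Type*} [Group Γ] {d : ℕ} (t : Fin d → Γ)
    (ht : Subgroup.closure (Set.range t) = ⊤) :
    Function.Surjective (FreeGroup.lift t) := by
  rw [← MonoidHom.range_eq_top, FreeGroup.range_lift_eq_closure, ht]

theorem lower {G : Type*} [Group G] (Q : Type*) [Group Q] [Finite Q] [Nontrivial Q]
    (ψ : G →* Q) (hψ : Function.Surjective ψ) {n k : ℕ} (θ : FreeGroup (Fin k) →* (Fin n → G))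
    (hθ : Function.Surjective θ) : n ≤ Nat.card Q ^ k := by
  let F : Fin n → (Fin k → Q) := fun i j => ψ (θ (FreeGroup.of j) i)
  have hF : Function.Injective F := by
    intro i i' h
    by_contra hne
    have h1 : (ψ.comp (Pi.evalMonoidHom (fun _ : Fin n => G) i)).comp θ =
        (ψ.comp (Pi.evalMonoidHom (fun _ : Fin n => G) i')).comp θ := by
      ext j
      exact congrFun h j
    obtain ⟨q, hq⟩ := exists_ne (1 : Q)
    obtain ⟨g, rfl⟩ := hψ q
    obtain ⟨w, hw⟩ := hθ (Pi.mulSingle i g)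
    have h2 := DFunLike.congr_fun h1 w
    simp [hw, Ne.symm hne] at h2
    exact hq h2
  have := Nat.card_le_card_of_injective F hF
  simpa [Nat.card_fun] using this

theorem gens_le_rels {Γ : Type*} [Group Γ] (pf : commutator Γ = ⊤) {k l : ℕ}
    (h : HasPresentationCard Γ k l) : k ≤ l := by
  obtain ⟨φ, hφ, R, hfin, hcard, hker⟩ := h
  by_contra hlt
  have : Fintype R := hfin.fintype
  let L : (Fin k → ℚ) → (FreeGroup (Fin k) →* Multiplicative ℚ) :=
    fun v => FreeGroup.lift (fun i => Multiplicative.ofAdd (v i))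
  have hL : ∀ v w, L (v + w) = L v * L w := by
    intro v w; ext i; simp [L]
  have hL0 : L 0 = 1 := by ext i; simp [L]
  let T0 : (Fin k → ℚ) →+ (R → ℚ) :=
    { toFun := fun v r => Multiplicative.toAdd (L v r)
      map_zero' := by ext r; simp [hL0]
      map_add' := fun v w => by ext r; simp [hL] }
  let T := T0.toRatLinearMap
  have hT : LinearMap.ker T ≠ ⊥ := by
    apply LinearMap.ker_ne_bot_of_finrank_lt
    rw [Module.finrank_fintype_fun_eq_card, Module.finrank_fintype_fun_eq_card, Fintype.card_fin]
    rw [← Nat.card_eq_fintype_card, Nat.card_coe_set_eq]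
    omega
  obtain ⟨v, hv, hv0⟩ := Submodule.exists_mem_ne_zero_of_ne_bot hT
  have h1 : ∀ r ∈ R, L v r = 1 := by
    intro r hr
    have := congrFun (LinearMap.mem_ker.1 hv) ⟨r, hr⟩
    exact this
  have h2 : φ.ker ≤ (L v).ker := by
    rw [hker]
    exact Subgroup.normalClosure_le_normal h1
  have h3 : ∀ x, L v x = 1 := by
    intro x
    have hx : φ x ∈ (commutator (FreeGroup (Fin k))).map φ := by
      rw [commutator_def, Subgroup.map_commutator, ← MonoidHom.range_eq_map,
        MonoidHom.range_eq_top.2 hφ, ← commutator_def, pf]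
      trivial
    obtain ⟨y, hy, hyx⟩ := hx
    have hy1 : L v y = 1 := Abelianization.commutator_subset_ker (L v) hy
    have : x * y⁻¹ ∈ φ.ker := by rw [MonoidHom.mem_ker, map_mul, map_inv, hyx, mul_inv_cancel]
    have := MonoidHom.mem_ker.1 (h2 this)
    rw [map_mul, map_inv, hy1] at this
    simpa using this
  apply hv0
  ext i
  have := h3 (FreeGroup.of i)
  simpa [L] using this

theorem perfect_pi {G : Type*} [Group G] (pf : commutator G = ⊤) (n : ℕ) :
    commutator (Fin n → G) = ⊤ := by
  have := Subgroup.commutator_pi_pi_of_finite (η := Fin n) (Gs := fun _ => G)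
    (fun _ => ⊤) (fun _ => ⊤)
  simp only [Subgroup.pi_top, ← commutator_def, pf] at this
  exact this

/-- `G^(a+b) = G^a × G^b`. -/
def splitEquiv (G : Type*) [Group G] (a b : ℕ) :
    (Fin a → G) × (Fin b → G) ≃* (Fin (a + b) → G) :=
  { ((Equiv.sumArrowEquivProdArrow (Fin a) (Fin b) G).symm.trans
      (Equiv.arrowCongr finSumFinEquiv (Equiv.refl G))) with
    map_mul' := by
      intro x y
      ext i
      obtain ⟨j, rfl⟩ := finSumFinEquiv.surjective i
      rcases j with j | j <;> simp [Equiv.sumArrowEquivProdArrow] }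

theorem sp_pow {G : Type u} [Group G] (pf : commutator G = ⊤) (sp : SP G) (k : ℕ) :
    SP (Fin (2 ^ k) → G) := by
  induction k with
  | zero =>
    exact sp_equiv (MulEquiv.funUnique (Fin 1) G).symm sp
  | succ k ih =>
    have := sp_equiv (splitEquiv G _ _) (sp_prod ih ih (perfect_pi pf _) (perfect_pi pf _))
    rw [pow_succ, mul_two]
    exact this

theorem pres_mono {Γ : Type*} [Group Γ] {k l l' : ℕ} (h : HasPresentationCard Γ k l)
    (hl : l ≤ l') : HasPresentationCard Γ k l' := by
  obtain ⟨φ, hφ, R, hfin, hcard, hker⟩ := h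
  exact ⟨φ, hφ, R, hfin, hcard.trans hl, hker⟩

theorem pres_pow {G : Type u} [Group G] (pf : commutator G = ⊤) (sp : SP G) {m l : ℕ}
    (g : Fin m → G) (hg : Subgroup.closure (Set.range g) = ⊤)
    {α : Type} (h0 : Pres G α l) (k : ℕ) :
    HasPresentationCard (Fin (2 ^ k) → G) (m * (k + 1))
      ((l + 3 * (m * m + m)) * (k + 1) ^ 3) := by
  induction k with
  | zero =>
    obtain ⟨t, ht⟩ := gen_pow pf g hg (n := 2 ^ 0) (K := 0) le_rfl
    refine pres_mono (change_gens h0 (MulEquiv.funUnique (Fin 1) G).symm _ (lift_surj t ht)) ?_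
    nlinarith
  | succ k ih =>
    obtain ⟨t, ht⟩ := gen_pow pf g hg (n := 2 ^ (k + 1)) (K := k + 1) le_rfl
    have e : (Fin (2 ^ k) → G) × (Fin (2 ^ k) → G) ≃* (Fin (2 ^ (k + 1)) → G) := by
      rw [pow_succ, mul_two]
      exact splitEquiv G _ _
    have hd := double ih (sp_pow pf sp k) (perfect_pi pf _)
    refine pres_mono (change_gens hd e _ (lift_surj t ht)) ?_
    have : m * (k + 1) * (m * (k + 1)) + m * (k + 1) + m * (k + 1 + 1) ≤
        (l + 3 * (m * m + m)) * (3 * (k + 1) ^ 2 + 3 * (k + 1) + 1) := by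
      have h1 : m * (k + 1) * (m * (k + 1)) = m * m * (k + 1) ^ 2 := by ring
      rw [h1]
      have h2 : m * m * (k + 1) ^ 2 ≤ (l + 3 * (m * m + m)) * (3 * (k + 1) ^ 2) :=
        Nat.mul_le_mul (by omega) (by omega)
      have h3 : (m + m) * (k + 1) ≤ (l + 3 * (m * m + m)) * (3 * (k + 1)) :=
        Nat.mul_le_mul (by omega) (by omega)
      have h4 : m * 1 ≤ (l + 3 * (m * m + m)) * 1 := Nat.mul_le_mul (by omega) (by omega)
      nlinarith
    nlinarith

theorem pres_all {G : Type u} [Group G] (pf : commutator G = ⊤) (sp : SP G) {m l : ℕ}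
    (g : Fin m → G) (hg : Subgroup.closure (Set.range g) = ⊤)
    {α : Type} (h0 : Pres G α l) {n k : ℕ} (hn : n ≤ 2 ^ k) :
    HasPresentationCard (Fin n → G) (m * (k + 1))
      ((l + 3 * (m * m + m)) * (k + 1) ^ 3 + m * (k + 1)) := by
  obtain ⟨t, ht⟩ := gen_pow pf g hg (n := 2 ^ k) (K := k) le_rfl
  let p : (Fin (2 ^ k) → G) →* (Fin n → G) :=
    { toFun := fun f i => f (Fin.castLE hn i)
      map_one' := rfl
      map_mul' := fun _ _ => rfl }
  let q : (Fin (2 ^ k) → G) →* (Fin (2 ^ k) → G) :=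
    { toFun := fun f i => if (i : ℕ) < n then 1 else f i
      map_one' := by ext; simp
      map_mul' := fun a b => by ext i; by_cases h : (i : ℕ) < n <;> simp [h] }
  refine kill (pres_pow pf sp g hg h0 k) p ?_ (fun j => q (t j)) ?_
  · intro f
    refine ⟨fun i => if h : (i : ℕ) < n then f ⟨i, h⟩ else 1, ?_⟩
    ext i
    simp [p]
  · have : Set.range (fun j => q (t j)) = q '' Set.range t := by
      rw [← Set.range_comp]; rfl
    rw [this, ← MonoidHom.map_closure, ht, ← MonoidHom.range_eq_map]
    ext f
    rw [MonoidHom.mem_ker, MonoidHom.mem_range]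
    constructor
    · intro h
      refine ⟨f, ?_⟩
      ext i
      by_cases hi : (i : ℕ) < n
      · have := congrFun h ⟨i, hi⟩
        simp only [q, MonoidHom.coe_mk, OneHom.coe_mk, hi, if_true]
        exact this.symm
      · simp [q, hi]
    · rintro ⟨f, rfl⟩
      ext i
      simp [p, q]

theorem log_bound {n : ℕ} (hn : 2 ≤ n) : ((Nat.clog 2 n + 1 : ℕ) : ℝ) ≤ 6 * Real.log n := by
  have hl2 := Real.log_two_gt_d9
  have hnpos : (0 : ℝ) < n := by positivity
  have h1 : 2 ^ (Nat.clog 2 n - 1) ≤ n := by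
    have := Nat.pow_pred_clog_lt_self (b := 2) (by norm_num) (x := n) (by omega)
    exact this.le
  have h2 : ((Nat.clog 2 n - 1 : ℕ) : ℝ) * Real.log 2 ≤ Real.log n := by
    rw [← Real.log_pow]
    apply Real.log_le_log (by positivity)
    exact_mod_cast h1
  have h3 : Real.log 2 ≤ Real.log n := Real.log_le_log (by norm_num) (by exact_mod_cast hn)
  have h4 : ((Nat.clog 2 n + 1 : ℕ) : ℝ) ≤ ((Nat.clog 2 n - 1 : ℕ) : ℝ) + 2 := by
    norm_cast; omega
  have h5 : (0 : ℝ) ≤ ((Nat.clog 2 n - 1 : ℕ) : ℝ) := by positivity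
  nlinarith

end Powers

/-- If `G` is finitely presented with `H₁(G,ℤ) = H₂(G,ℤ) = 0` and `G` has a
non-trivial finite quotient, then `d(Gⁿ) = Θ(log n)` and
`c₀ log n ≤ ρ(Gⁿ) ≤ c₁ (log n)³`. -/
theorem stmt_3 (G : Type*) [Group G] (hFP : FinitelyPresented G)
    (hH1 : Subsingleton (Abelianization G)) (hH2 : Subsingleton (H2 G))
    (Q : Type*) [Group Q] [Finite Q] [Nontrivial Q]
    (ψ : G →* Q) (hψ : Function.Surjective ψ) :
    ∃ c C c₀ c₁ : ℝ, 0 < c ∧ 0 < C ∧ 0 < c₀ ∧ 0 < c₁ ∧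
      ∀ n : ℕ, 2 ≤ n →
        c * Real.log n ≤ (dGen (Fin n → G) : ℝ) ∧
        (dGen (Fin n → G) : ℝ) ≤ C * Real.log n ∧
        c₀ * Real.log n ≤ (rho (Fin n → G) : ℝ) ∧
        (rho (Fin n → G) : ℝ) ≤ c₁ * Real.log n ^ 3 := by
  have pf : commutator G = ⊤ := by
    have : Subsingleton (G ⧸ commutator G) := hH1
    exact QuotientGroup.subgroup_eq_top_of_subsingleton _ this
  have sp : Powers.SP G := Powers.sp_of_H2 G hH2
  obtain ⟨m, l, hP⟩ := hFP
  have h0 : Powers.Pres G (Fin m) l := hP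
  obtain ⟨φ, hφ, -⟩ := hP
  have hg : Subgroup.closure (Set.range (fun i => φ (FreeGroup.of i))) = ⊤ := by
    rw [← MonoidHom.range_eq_top.2 hφ, MonoidHom.range_eq_map, ← FreeGroup.closure_range_of,
      MonoidHom.map_closure, ← Set.range_comp]
    rfl
  set g : Fin m → G := fun i => φ (FreeGroup.of i) with hgdef
  have hq : 1 < Nat.card Q := Finite.one_lt_card
  have hlq : 0 < Real.log (Nat.card Q) := Real.log_pos (by exact_mod_cast hq)
  have low : ∀ n d : ℕ, 2 ≤ n → n ≤ Nat.card Q ^ d →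
      (Real.log (Nat.card Q))⁻¹ * Real.log n ≤ d := by
    intro n d hn h
    rw [inv_mul_le_iff₀ hlq, mul_comm, ← Real.log_pow]
    apply Real.log_le_log
    · positivity
    · exact_mod_cast h
  refine ⟨(Real.log (Nat.card Q))⁻¹, 6 * m + 1, (Real.log (Nat.card Q))⁻¹,
    ((l + 3 * (m * m + m)) * 216 + m * 216 + 1), by positivity, by positivity, by positivity,
    by positivity, ?_⟩
  intro n hn
  have hK : n ≤ 2 ^ Nat.clog 2 n := Nat.le_pow_clog (by norm_num) n
  have hlog := Powers.log_bound hn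
  set K := Nat.clog 2 n with hKdef
  have hlogpos : 0 ≤ Real.log n := Real.log_natCast_nonneg n
  obtain ⟨t, ht⟩ := Powers.gen_pow pf g hg hK
  have hpres := Powers.pres_all pf sp g hg h0 hK
  have hdmem : (Set.range t).ncard ∈
      {d | ∃ S : Set (Fin n → G), S.Finite ∧ S.ncard = d ∧ Subgroup.closure S = ⊤} :=
    ⟨_, Set.finite_range t, rfl, ht⟩
  have hrmem : (l + 3 * (m * m + m)) * (K + 1) ^ 3 + m * (K + 1) ∈
      {l | ∃ k, HasPresentationCard (Fin n → G) k l} := ⟨_, hpres⟩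
  refine ⟨?_, ?_, ?_, ?_⟩
  · obtain ⟨S, hS, hSd, hcl⟩ := Nat.sInf_mem ⟨_, hdmem⟩
    apply low n _ hn
    change n ≤ Nat.card Q ^ dGen (Fin n → G)
    change S.ncard = dGen (Fin n → G) at hSd
    have : Finite S := hS
    have e : S ≃ Fin (dGen (Fin n → G)) := by
      refine Finite.equivFinOfCardEq ?_
      rw [Nat.card_coe_set_eq, hSd]
    have hr : Set.range (fun i => ((e.symm i : S) : Fin n → G)) = S := by
      have := e.symm.surjective.range_comp (Subtype.val : S → (Fin n → G))
      rw [Subtype.range_coe] at this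
      exact this
    exact Powers.lower Q ψ hψ _ (Powers.lift_surj (fun i => ((e.symm i : S) : Fin n → G))
      (by rw [hr, hcl]))
  · have h1 : dGen (Fin n → G) ≤ m * (K + 1) := by
      refine (Nat.sInf_le hdmem).trans ((Powers.ncard_range_le t).trans ?_)
      simp
    have h2 : (dGen (Fin n → G) : ℝ) ≤ m * ((K + 1 : ℕ) : ℝ) := by exact_mod_cast h1
    have h3 : (m : ℝ) * ((K + 1 : ℕ) : ℝ) ≤ m * (6 * Real.log n) := by gcongr
    linarith
  · obtain ⟨k, hk⟩ := Nat.sInf_mem ⟨_, hrmem⟩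
    change HasPresentationCard (Fin n → G) k (rho (Fin n → G)) at hk
    have hkl := Powers.gens_le_rels (Powers.perfect_pi pf n) hk
    obtain ⟨θ, hθ, -⟩ := hk
    have := low n k hn (Powers.lower Q ψ hψ θ hθ)
    exact this.trans (by exact_mod_cast hkl)
  · have h1 : rho (Fin n → G) ≤ (l + 3 * (m * m + m)) * (K + 1) ^ 3 + m * (K + 1) :=
      Nat.sInf_le hrmem
    have h1' : rho (Fin n → G) ≤ (l + 3 * (m * m + m)) * (K + 1) ^ 3 + m * (K + 1) ^ 3 := by
      refine h1.trans ?_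
      gcongr
      exact Nat.le_self_pow (by norm_num) _
    have h2 : (rho (Fin n → G) : ℝ) ≤ (l + 3 * (m * m + m)) * ((K + 1 : ℕ) : ℝ) ^ 3
        + m * ((K + 1 : ℕ) : ℝ) ^ 3 := by exact_mod_cast h1'
    have h3 : ((K + 1 : ℕ) : ℝ) ^ 3 ≤ (6 * Real.log n) ^ 3 := by gcongr
    have h4 : (0 : ℝ) ≤ Real.log n ^ 3 := by positivity
    calc (rho (Fin n → G) : ℝ) ≤ (l + 3 * (m * m + m)) * ((K + 1 : ℕ) : ℝ) ^ 3
        + m * ((K + 1 : ℕ) : ℝ) ^ 3 := h2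
      _ ≤ (l + 3 * (m * m + m)) * (6 * Real.log n) ^ 3 + m * (6 * Real.log n) ^ 3 := by gcongr
      _ ≤ _ := by nlinarith
end

section
/- Let G = ⟨x₁,…,x_k | r₁,…,r_l⟩ be a finitely presented group with H_1(G,ℤ) = 0 and H_2(G,ℤ) = 0. If d(G^N) ≤ k for some integer N, and n is a non-negative integer with 2ⁿ ≤ N, then G^{2ⁿ} has a presentation with k generators and n(k² + 2k) + l relators. -/
open scoped commutatorElement

/-- `G` lifts through all central extensions. -/
def LiftsCentral (G : Type) [Group G] : Prop :=
  ∀ (E Q : Type) [Group E] [Group Q] (p : E →* Q) (_ : Function.Surjective p)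
    (_ : p.ker ≤ Subgroup.center E) (f : G →* Q), ∃ s : G →* E, p.comp s = f

theorem mem_comm_image {G H : Type*} [Group G] [Group H] (f : G →* H) {x : G}
    (hx : x ∈ commutator G) : f x ∈ commutator H := by
  have h : (commutator G).map f ≤ commutator H := by
    rw [commutator_def, commutator_def, Subgroup.map_commutator]
    exact Subgroup.commutator_mono le_top le_top
  exact h ⟨x, hx, rfl⟩

theorem exists_comm_preimage {G H : Type*} [Group G] [Group H] (f : G →* H)
    (hf : Function.Surjective f) (hH : commutator H = ⊤) (y : H) :
    ∃ x ∈ commutator G, f x = y := by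
  have h : (commutator G).map f = commutator H := by
    rw [commutator_def, commutator_def, Subgroup.map_commutator,
      Subgroup.map_top_of_surjective f hf]
  have hy : y ∈ (commutator G).map f := by rw [h, hH]; trivial
  exact hy

theorem perfect_prod {G H : Type*} [Group G] [Group H] (hG : commutator G = ⊤)
    (hH : commutator H = ⊤) : commutator (G × H) = ⊤ := by
  rw [eq_top_iff]
  rintro ⟨g, h⟩ -
  have h1 := mem_comm_image (MonoidHom.inl G H) (x := g) (by rw [hG]; trivial)
  have h2 := mem_comm_image (MonoidHom.inr G H) (x := h) (by rw [hH]; trivial)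
  simpa using mul_mem h1 h2

theorem perfect_of_equiv {G H : Type*} [Group G] [Group H] (e : G ≃* H)
    (hG : commutator G = ⊤) : commutator H = ⊤ := by
  rw [eq_top_iff]
  intro h _
  have h1 := mem_comm_image e.toMonoidHom (x := e.symm h) (by rw [hG]; trivial)
  simpa using h1

theorem lifts_of_equiv {G H : Type} [Group G] [Group H] (e : G ≃* H)
    (hG : LiftsCentral G) : LiftsCentral H := by
  intro E Q _ _ p hp hc f
  obtain ⟨s, hs⟩ := hG E Q p hp hc (f.comp e.toMonoidHom)
  refine ⟨s.comp e.symm.toMonoidHom, ?_⟩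
  rw [← MonoidHom.comp_assoc, hs]
  ext x
  simp

theorem comm_trivial {G E : Type*} [Group G] [Group E] (hG : commutator G = ⊤) (s : G →* E)
    (e : E) (hc : ∀ g, ⁅s g, e⁆ ∈ Subgroup.center E) (g : G) : Commute (s g) e := by
  let f : G →* Subgroup.center E := MonoidHom.mk' (fun g => ⟨⁅s g, e⁆, hc g⟩) (by
    intro a b
    apply Subtype.ext
    have h := Subgroup.mem_center_iff.1 (hc b) (s a)
    have h' := Subgroup.mem_center_iff.1 (hc b) ⁅s a, e⁆
    show ⁅s (a * b), e⁆ = ⁅s a, e⁆ * ⁅s b, e⁆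
    calc ⁅s (a * b), e⁆ = (s a * ⁅s b, e⁆) * (s a)⁻¹ * ⁅s a, e⁆ := by
          simp only [commutatorElement_def, map_mul]; group
      _ = ⁅s a, e⁆ * ⁅s b, e⁆ := by rw [h, h']; group)
  have h0 : commutator G ≤ f.ker := by
    rw [commutator_def, Subgroup.commutator_le]
    intro a _ b _
    rw [MonoidHom.mem_ker, map_commutatorElement, commutatorElement_eq_one_iff_commute]
    apply Subtype.ext
    exact Subgroup.mem_center_iff.1 (f b).2 (f a : E)
  have h1 : g ∈ f.ker := h0 (by rw [hG]; trivial)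
  have h2 : ⁅s g, e⁆ = 1 := congrArg Subtype.val (MonoidHom.mem_ker.1 h1)
  exact commutatorElement_eq_one_iff_commute.1 h2

theorem lifts_prod {G H : Type} [Group G] [Group H] (pG : commutator G = ⊤)
    (hG : LiftsCentral G) (hH : LiftsCentral H) : LiftsCentral (G × H) := by
  intro E Q _ _ p hp hc f
  obtain ⟨s, hs⟩ := hG E Q p hp hc (f.comp (MonoidHom.inl G H))
  obtain ⟨t, ht⟩ := hH E Q p hp hc (f.comp (MonoidHom.inr G H))
  have hs' : ∀ g, p (s g) = f (g, 1) := fun g => DFunLike.congr_fun hs g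
  have ht' : ∀ h, p (t h) = f (1, h) := fun g => DFunLike.congr_fun ht g
  have comm : ∀ g h, Commute (s g) (t h) := by
    intro g h
    refine comm_trivial pG s (t h) (fun g => hc ?_) g
    rw [MonoidHom.mem_ker, map_commutatorElement, hs', ht', ← map_commutatorElement]
    rw [commutatorElement_eq_one_iff_commute.2, map_one]
    simp [Commute, SemiconjBy]
  refine ⟨s.noncommCoprod t comm, ?_⟩
  ext ⟨g, h⟩
  rw [MonoidHom.comp_apply, MonoidHom.noncommCoprod_apply, map_mul, hs', ht', ← map_mul]
  simp

theorem lifts_of_H2 {G : Type} [Group G] (pG : commutator G = ⊤) (h2 : Subsingleton (H2 G)) :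
    LiftsCentral G := by
  intro E Q _ _ p hp hc f
  let q : FreeGroup G →* G := FreeGroup.lift id
  have hq : Function.Surjective q := fun g => ⟨FreeGroup.of g, by simp [q]⟩
  choose e he using fun g => hp (f g)
  let σ : FreeGroup G →* E := FreeGroup.lift e
  have hσ : ∀ x, p (σ x) = f (q x) := by
    intro x
    have : p.comp σ = f.comp q := by
      ext g
      simp [σ, q, he]
    exact DFunLike.congr_fun this x
  -- restrict to commutator
  let q' : commutator (FreeGroup G) →* G := q.comp (Subgroup.subtype _)
  have hq' : Function.Surjective q' := by
    intro g
    obtain ⟨x, hx, h⟩ := exists_comm_preimage q hq pG g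
    exact ⟨⟨x, hx⟩, h⟩
  let σ' : commutator (FreeGroup G) →* E := σ.comp (Subgroup.subtype _)
  have hker : q'.ker ≤ σ'.ker := by
    rintro ⟨x, hx⟩ hk
    have hk' : x ∈ freeKernel G := hk
    have hmem : x ∈ ⁅(⊤ : Subgroup (FreeGroup G)), freeKernel G⁆ := by
      have := QuotientGroup.eq.1 (h2.elim
        (QuotientGroup.mk (1 : ↥(freeKernel G ⊓ commutator (FreeGroup G))))
        (QuotientGroup.mk ⟨x, hk', hx⟩))
      simpa [Subgroup.mem_subgroupOf] using this
    have hle : ⁅(⊤ : Subgroup (FreeGroup G)), freeKernel G⁆ ≤ σ.ker := by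
      rw [Subgroup.commutator_le]
      intro a _ b hb
      rw [MonoidHom.mem_ker, map_commutatorElement, commutatorElement_eq_one_iff_commute]
      have hb' : σ b ∈ Subgroup.center E := hc (by
        rw [MonoidHom.mem_ker, hσ]
        have : q b = 1 := hb
        rw [this, map_one])
      exact Subgroup.mem_center_iff.1 hb' (σ a)
    exact hle hmem
  refine ⟨q'.liftOfRightInverse _ (Function.rightInverse_surjInv hq') ⟨σ', hker⟩, ?_⟩
  ext g
  obtain ⟨x, rfl⟩ := hq' g
  have h := q'.liftOfRightInverse_comp_apply _ (Function.rightInverse_surjInv hq') ⟨σ', hker⟩ x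
  rw [MonoidHom.comp_apply, h]
  exact hσ x

/-- A perfect central extension of a group with the lifting property is trivial. -/
theorem inj_of_central {G P : Type} [Group G] [Group P] (hG : LiftsCentral G)
    (π : P →* G) (hπ : Function.Surjective π) (hc : π.ker ≤ Subgroup.center P)
    (hP : commutator P = ⊤) : Function.Injective π := by
  obtain ⟨s, hs⟩ := hG P G π hπ hc (MonoidHom.id G)
  have hs' : ∀ g, π (s g) = g := fun g => DFunLike.congr_fun hs g
  have hdec : ∀ x, ∃ z ∈ Subgroup.center P, x = s (π x) * z := by
    intro x
    refine ⟨(s (π x))⁻¹ * x, hc ?_, by group⟩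
    simp [MonoidHom.mem_ker, hs']
  have hle : commutator P ≤ s.range := by
    rw [commutator_def, Subgroup.commutator_le]
    intro a _ b _
    obtain ⟨z, hz, ha⟩ := hdec a
    obtain ⟨w, hw, hb⟩ := hdec b
    refine ⟨⁅π a, π b⁆, ?_⟩
    have hz' : ∀ g, Commute g z := Subgroup.mem_center_iff.1 hz
    have hw' : ∀ g, Commute g w := Subgroup.mem_center_iff.1 hw
    conv_rhs => rw [ha, hb]
    rw [map_commutatorElement]
    generalize s (π a) = A
    generalize s (π b) = B
    have e1 : A * z * (B * w) = A * B * (z * w) := by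
      rw [mul_assoc A, ← mul_assoc z, ← (hz' B).eq]; group
    have e2 : B * w * (A * z) = B * A * (z * w) := by
      rw [mul_assoc B, ← mul_assoc w, ← (hw' A).eq, (hw' z).eq]; group
    have e3 : ⁅A * z, B * w⁆ = (A * z * (B * w)) * (B * w * (A * z))⁻¹ := by
      rw [commutatorElement_def]; group
    rw [e3, e1, e2, commutatorElement_def]; group
  rw [injective_iff_map_eq_one]
  intro x hx
  obtain ⟨g, rfl⟩ := hle (show x ∈ commutator P by rw [hP]; trivial)
  rw [hs'] at hx
  rw [hx, map_one]

theorem ncard_range_le' {ι α : Type*} [Finite ι] (f : ι → α) :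
    (Set.range f).ncard ≤ Nat.card ι := by
  rw [← Set.image_univ]
  exact (Set.ncard_image_le Set.finite_univ).trans (Set.ncard_univ ι).le

theorem pres_step {G : Type} [Group G] {k l : ℕ} (pG : commutator G = ⊤) (hG : LiftsCentral G)
    (h : HasPresentationCard G k l) (ψ : FreeGroup (Fin k) →* G × G)
    (hψ : Function.Surjective ψ) : HasPresentationCard (G × G) k (k ^ 2 + 2 * k + l) := by
  obtain ⟨φ, hφ, R, hRf, hRc, hR⟩ := h
  choose X hX using fun i : Fin k => hψ (φ (FreeGroup.of i), 1)
  choose Y hY using fun i : Fin k => hψ (1, φ (FreeGroup.of i))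
  let ξ : FreeGroup (Fin k) →* FreeGroup (Fin k) := FreeGroup.lift X
  let η : FreeGroup (Fin k) →* FreeGroup (Fin k) := FreeGroup.lift Y
  have hξ : ∀ x, ψ (ξ x) = (φ x, 1) := by
    have : ψ.comp ξ = (MonoidHom.inl G G).comp φ := by
      ext1 i; simp [ξ, hX]
    exact fun x => DFunLike.congr_fun this x
  have hη : ∀ x, ψ (η x) = (1, φ x) := by
    have : ψ.comp η = (MonoidHom.inr G G).comp φ := by
      ext1 i; simp [η, hY]
    exact fun x => DFunLike.congr_fun this x
  choose u hu using fun i : Fin k => hφ (ψ (FreeGroup.of i)).1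
  choose v hv using fun i : Fin k => hφ (ψ (FreeGroup.of i)).2
  choose c hc hcψ using fun i : Fin k =>
    exists_comm_preimage ψ hψ (perfect_prod pG pG) (ψ (FreeGroup.of i))
  let S1 : Set (FreeGroup (Fin k)) := Set.range fun p : Fin k × Fin k => ⁅X p.1, Y p.2⁆
  let S2 : Set (FreeGroup (Fin k)) :=
    Set.range fun i : Fin k => (FreeGroup.of i)⁻¹ * (ξ (u i) * η (v i))
  let S3 : Set (FreeGroup (Fin k)) := Set.range fun i : Fin k => (FreeGroup.of i)⁻¹ * c i
  let S4 : Set (FreeGroup (Fin k)) := (fun r => ξ r * η r) '' R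
  let S := S1 ∪ S2 ∪ S3 ∪ S4
  have hS4f : S4.Finite := hRf.image _
  have hSfin : S.Finite :=
    (((Set.finite_range _).union (Set.finite_range _)).union (Set.finite_range _)).union hS4f
  have hScard : S.ncard ≤ k ^ 2 + 2 * k + l := by
    have h1 : S1.ncard ≤ k * k := (ncard_range_le' _).trans (by simp)
    have h2 : S2.ncard ≤ k := (ncard_range_le' _).trans (by simp)
    have h3 : S3.ncard ≤ k := (ncard_range_le' _).trans (by simp)
    have h4 : S4.ncard ≤ l := (Set.ncard_image_le hRf).trans hRc
    have a1 := Set.ncard_union_le (S1 ∪ S2 ∪ S3) S4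
    have a2 := Set.ncard_union_le (S1 ∪ S2) S3
    have a3 := Set.ncard_union_le S1 S2
    show (S1 ∪ S2 ∪ S3 ∪ S4).ncard ≤ _
    rw [pow_two]
    omega
  refine ⟨ψ, hψ, S, hSfin, hScard, ?_⟩
  have hle : Subgroup.normalClosure S ≤ ψ.ker := by
    apply Subgroup.normalClosure_le_normal
    rintro x (((⟨⟨i, j⟩, rfl⟩ | ⟨i, rfl⟩) | ⟨i, rfl⟩) | ⟨r, hr, rfl⟩)
    · show ψ _ = 1
      rw [map_commutatorElement, hX, hY, commutatorElement_eq_one_iff_commute]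
      simp [Commute, SemiconjBy]
    · show ψ _ = 1
      rw [map_mul, map_mul, hξ, hη, hu, hv, map_inv]
      simp
    · show ψ _ = 1
      rw [map_mul, hcψ, map_inv]
      simp
    · show ψ _ = 1
      have : φ r = 1 := by
        rw [← MonoidHom.mem_ker, hR]; exact Subgroup.subset_normalClosure hr
      rw [map_mul, hξ, hη, this]
      simp
  refine le_antisymm ?_ hle
  let P := FreeGroup (Fin k) ⧸ Subgroup.normalClosure S
  let q : FreeGroup (Fin k) →* P := QuotientGroup.mk' _
  have hqs : Function.Surjective q := QuotientGroup.mk'_surjective _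
  have hq1 : ∀ x ∈ S, q x = 1 := fun x hx =>
    (QuotientGroup.eq_one_iff x).2 (Subgroup.subset_normalClosure hx)
  let π : P →* G × G := QuotientGroup.lift _ ψ hle
  have hπ : ∀ x, π (q x) = ψ x := fun x => rfl
  have hπs : Function.Surjective π := fun y => by
    obtain ⟨x, rfl⟩ := hψ y
    exact ⟨q x, rfl⟩
  have hXY : ∀ i j, Commute (q (X i)) (q (Y j)) := by
    intro i j
    rw [← commutatorElement_eq_one_iff_commute, ← map_commutatorElement]
    exact hq1 _ (Or.inl (Or.inl (Or.inl ⟨(i, j), rfl⟩)))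
  have hcommX : ∀ (i : Fin k) (y : FreeGroup (Fin k)), Commute (q (X i)) (q (η y)) := by
    intro i y
    induction y using FreeGroup.induction_on with
    | C1 => simp
    | of j => simpa [η] using hXY i j
    | inv_of j h => simpa only [map_inv] using h.inv_right
    | mul a b ha hb => simpa only [map_mul] using ha.mul_right hb
  have hcomm : ∀ x y : FreeGroup (Fin k), Commute (q (ξ x)) (q (η y)) := by
    intro x y
    induction x using FreeGroup.induction_on with
    | C1 => simp
    | of j => simpa [ξ] using hcommX j y
    | inv_of j h => simpa only [map_inv] using h.inv_left
    | mul a b ha hb => simpa only [map_mul] using ha.mul_left hb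
  let m : FreeGroup (Fin k) × FreeGroup (Fin k) →* P :=
    (q.comp ξ).noncommCoprod (q.comp η) hcomm
  have hm : ∀ x y, m (x, y) = q (ξ x) * q (η y) := fun x y => by simp [m]
  have hms : ∀ p : P, ∃ x y, p = q (ξ x) * q (η y) := by
    have : ∀ a, q a ∈ m.range := by
      intro a
      induction a using FreeGroup.induction_on with
      | C1 => rw [map_one]; exact one_mem _
      | of i =>
        refine ⟨(u i, v i), ?_⟩
        rw [hm, ← map_mul]
        have := hq1 _ (Or.inl (Or.inl (Or.inr ⟨i, rfl⟩)))
        rw [map_mul, map_inv] at this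
        exact (inv_mul_eq_one.1 this).symm
      | inv_of j h => rw [map_inv]; exact inv_mem h
      | mul a b ha hb => rw [map_mul]; exact mul_mem ha hb
    intro p
    obtain ⟨a, rfl⟩ := hqs p
    obtain ⟨⟨x, y⟩, h⟩ := this a
    exact ⟨x, y, by rw [← h, hm]⟩
  have hrel : ∀ r ∈ R, q (ξ r) = (q (η r))⁻¹ := by
    intro r hr
    have := hq1 _ (Or.inr ⟨r, hr, rfl⟩)
    rw [map_mul] at this
    exact eq_inv_of_mul_eq_one_left this
  have hcenter : ∀ z : P, (∀ x, Commute (q (ξ x)) z) → (∀ y, Commute (q (η y)) z) →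
      z ∈ Subgroup.center P := by
    intro z h1 h2
    rw [Subgroup.mem_center_iff]
    intro g
    obtain ⟨x, y, rfl⟩ := hms g
    exact (h1 x).mul_left (h2 y)
  have hRξ : ∀ r ∈ R, q (ξ r) ∈ Subgroup.center P := by
    intro r hr
    apply hcenter
    · intro x
      rw [hrel r hr]
      exact (hcomm x r).inv_right
    · intro y
      exact (hcomm r y).symm
  have hRη : ∀ r ∈ R, q (η r) ∈ Subgroup.center P := by
    intro r hr
    have := inv_mem (hRξ r hr)
    rwa [hrel r hr, inv_inv] at this
  have hKξ : φ.ker ≤ (Subgroup.center P).comap (q.comp ξ) := by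
    rw [hR]
    exact Subgroup.normalClosure_le_normal hRξ
  have hKη : φ.ker ≤ (Subgroup.center P).comap (q.comp η) := by
    rw [hR]
    exact Subgroup.normalClosure_le_normal hRη
  have hπc : π.ker ≤ Subgroup.center P := by
    intro p hp
    obtain ⟨x, y, rfl⟩ := hms p
    rw [MonoidHom.mem_ker, map_mul, hπ, hπ, hξ, hη] at hp
    have hx : φ x = 1 := by simpa using congrArg Prod.fst hp
    have hy : φ y = 1 := by simpa using congrArg Prod.snd hp
    exact mul_mem (hKξ hx) (hKη hy)
  have hPp : commutator P = ⊤ := by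
    rw [eq_top_iff]
    intro p _
    obtain ⟨a, rfl⟩ := hqs p
    induction a using FreeGroup.induction_on with
    | C1 => rw [map_one]; exact one_mem _
    | of i =>
      have := hq1 _ (Or.inl (Or.inr ⟨i, rfl⟩))
      rw [map_mul, map_inv] at this
      have h' := inv_mul_eq_one.1 this
      show q (FreeGroup.of i) ∈ _
      rw [h']
      exact mem_comm_image q (hc i)
    | inv_of j h => rw [map_inv]; exact inv_mem (h trivial)
    | mul a b ha hb => rw [map_mul]; exact mul_mem (ha trivial) (hb trivial)
  have hinj := inj_of_central (lifts_prod pG hG hG) π hπs hπc hPp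
  intro x hx
  have : q x = 1 := hinj (by rw [hπ, map_one]; exact hx)
  exact (QuotientGroup.eq_one_iff x).1 this

theorem pres_of_equiv {G H : Type} [Group G] [Group H] (e : G ≃* H) {k l : ℕ}
    (h : HasPresentationCard G k l) : HasPresentationCard H k l := by
  obtain ⟨φ, hφ, R, hf, hc, hR⟩ := h
  refine ⟨e.toMonoidHom.comp φ, e.surjective.comp hφ, R, hf, hc, ?_⟩
  rw [← hR]
  ext x
  simp [MonoidHom.mem_ker]

/-- Splitting a power into two halves. -/
def powSplit (G : Type) [Group G] (n : ℕ) :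
    ((Fin (2 ^ n) → G) × (Fin (2 ^ n) → G)) ≃* (Fin (2 ^ (n + 1)) → G) where
  toEquiv := (Equiv.sumArrowEquivProdArrow _ _ G).symm.trans
    (Equiv.arrowCongr (finSumFinEquiv.trans (finCongr (by rw [pow_succ]; omega))) (Equiv.refl G))
  map_mul' := by
    rintro ⟨a, b⟩ ⟨c, d⟩
    funext i
    simp only [Equiv.toFun_as_coe, Equiv.trans_apply, Equiv.arrowCongr_apply, Function.comp,
      Pi.mul_apply, Equiv.refl_apply]
    generalize (finSumFinEquiv.trans (finCongr (_ : 2 ^ n + 2 ^ n = 2 ^ (n + 1)))).symm i = j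
    cases j <;> rfl

theorem exists_surj_of_dGen {Γ : Type} [Group Γ] [Group.FG Γ] {k : ℕ} (h : dGen Γ ≤ k) :
    ∃ ψ : FreeGroup (Fin k) →* Γ, Function.Surjective ψ := by
  have hne : {d | ∃ S : Set Γ, S.Finite ∧ S.ncard = d ∧ Subgroup.closure S = ⊤}.Nonempty := by
    obtain ⟨S, hS, hf⟩ := Group.fg_iff.1 (inferInstance : Group.FG Γ)
    exact ⟨_, S, hf, rfl, hS⟩
  obtain ⟨S, hf, hc, hS⟩ := Nat.sInf_mem hne
  have hc' : S.ncard ≤ k := hc.le.trans h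
  have hex : ∃ f : Fin k → Γ, S ⊆ Set.range f := by
    have : Fintype S := hf.fintype
    have hcard : Fintype.card S ≤ k := by
      rw [← Nat.card_eq_fintype_card, Nat.card_coe_set_eq]; exact hc'
    let e := Fintype.equivFin S
    refine ⟨fun i => if hi : (i : ℕ) < Fintype.card S then (e.symm ⟨i, hi⟩ : Γ) else 1, ?_⟩
    intro x hx
    refine ⟨Fin.castLE hcard (e ⟨x, hx⟩), ?_⟩
    have hlt : ((Fin.castLE hcard (e ⟨x, hx⟩) : Fin k) : ℕ) < Fintype.card S := (e ⟨x, hx⟩).2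
    have he : (⟨((Fin.castLE hcard (e ⟨x, hx⟩) : Fin k) : ℕ), hlt⟩ : Fin (Fintype.card S)) = e ⟨x, hx⟩ := rfl
    simp only [dif_pos hlt, he, Equiv.symm_apply_apply]
  obtain ⟨f, hfS⟩ := hex
  refine ⟨FreeGroup.lift f, ?_⟩
  rw [← MonoidHom.range_eq_top, eq_top_iff, ← hS, Subgroup.closure_le]
  intro x hx
  obtain ⟨i, rfl⟩ := hfS hx
  exact ⟨FreeGroup.of i, by simp⟩

theorem main_ind {G : Type} [Group G] {k l : ℕ} (pG : commutator G = ⊤) (hG : LiftsCentral G)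
    (h : HasPresentationCard G k l) {N : ℕ} (ψ : FreeGroup (Fin k) →* (Fin N → G))
    (hψ : Function.Surjective ψ) (n : ℕ) (hn : 2 ^ n ≤ N) :
    commutator (Fin (2 ^ n) → G) = ⊤ ∧ LiftsCentral (Fin (2 ^ n) → G) ∧
      HasPresentationCard (Fin (2 ^ n) → G) k (n * (k ^ 2 + 2 * k) + l) := by
  induction n with
  | zero =>
    let e : G ≃* (Fin (2 ^ 0) → G) :=
      { toFun := fun g _ => g
        invFun := fun f => f 0
        left_inv := fun _ => rfl
        right_inv := fun f => by
          funext i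
          have : i = 0 := Subsingleton.elim (α := Fin 1) _ _
          rw [this]
        map_mul' := fun _ _ => rfl }
    refine ⟨perfect_of_equiv e pG, lifts_of_equiv e hG, ?_⟩
    rw [zero_mul, zero_add]
    exact pres_of_equiv e h
  | succ n ih =>
    obtain ⟨i1, i2, i3⟩ := ih ((Nat.pow_le_pow_right (by norm_num) n.le_succ).trans hn)
    let e := powSplit G n
    refine ⟨perfect_of_equiv e (perfect_prod i1 i1), lifts_of_equiv e (lifts_prod i1 i2 i2), ?_⟩
    let ρ : (Fin N → G) →* (Fin (2 ^ (n + 1)) → G) :=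
      { toFun := fun f i => f (Fin.castLE hn i)
        map_one' := rfl
        map_mul' := fun _ _ => rfl }
    have hρ : Function.Surjective ρ := by
      intro f
      refine ⟨fun i => if hi : (i : ℕ) < 2 ^ (n + 1) then f ⟨i, hi⟩ else 1, ?_⟩
      funext i
      simp [ρ]
    have := pres_step i1 i2 i3 ((e.symm.toMonoidHom.comp ρ).comp ψ)
      ((e.symm.surjective.comp hρ).comp hψ)
    have h2 := pres_of_equiv e this
    convert h2 using 1
    ring

/-- Lemma 2.4: if `G = ⟨x₁,…,x_k ∣ r₁,…,r_l⟩` with `H₁(G,ℤ) = H₂(G,ℤ) = 0`,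
`G^N` requires at most `k` generators and `2ⁿ ≤ N`, then `G^{2ⁿ}` has a
presentation with `k` generators and `n(k² + 2k) + l` relators. -/
theorem stmt_8 {k l : ℕ} (r : Fin l → FreeGroup (Fin k))
    (hH1 : Subsingleton (Abelianization (PresentedGroup (Set.range r))))
    (hH2 : Subsingleton (H2 (PresentedGroup (Set.range r))))
    {N : ℕ} (hN : dGen (Fin N → PresentedGroup (Set.range r)) ≤ k)
    (n : ℕ) (hn : 2 ^ n ≤ N) :
    HasPresentationCard (Fin (2 ^ n) → PresentedGroup (Set.range r)) k
      (n * (k ^ 2 + 2 * k) + l) := by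
  have pG : commutator (PresentedGroup (Set.range r)) = ⊤ := by
    rw [eq_top_iff]
    intro x _
    rw [← Abelianization.ker_of]
    exact hH1.elim _ _
  have hP : HasPresentationCard (PresentedGroup (Set.range r)) k l := by
    refine ⟨PresentedGroup.mk _, QuotientGroup.mk'_surjective _, Set.range r,
      Set.finite_range r, ?_, QuotientGroup.ker_mk' _⟩
    exact (ncard_range_le' r).trans (by simp)
  have : Group.FG (PresentedGroup (Set.range r)) :=
    Group.fg_of_surjective (f := PresentedGroup.mk (Set.range r)) (QuotientGroup.mk'_surjective _)
  obtain ⟨ψ, hψ⟩ := exists_surj_of_dGen hN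
  exact (main_ind pG (lifts_of_H2 pG hH2) hP ψ hψ n hn).2.2
end
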